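/- arXiv:2601.09517 — 2 statements merged into one kernel-verified Lean document; each statement's English description precedes it below -/
import Mathlib

section
/- Let L = ℚ(√d) be a real quadratic field (d ≥ 2 squarefree, embedded in ℝ with √d > 0) with fundamental unit η > 1, let ℓ ∈ ℕ and c = (c_1,…,c_ℓ) ∈ (L^×)^ℓ, and define T_{L,ℓ}^c(X) as the number of tuples (u_1,…,u_ℓ) ∈ (O_L^×)^ℓ with |Tr_{L/ℚ}(c_1 u_1) + ⋯ + Tr_{L/ℚ}(c_ℓ u_ℓ)| ≤ X, such that c_1 u_1 + ⋯ + c_ℓ u_ℓ + c_1' u_1' + ⋯ + c_ℓ' u_ℓ' has no vanishing subsum and |u_i| ≥ 1 for all i. Then for X ≥ 2, T_{L,ℓ}^c(X) ≥ (2 log X / log η)^ℓ + O_{L,ℓ,c}((log X)^{ℓ−1}). -/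
open NumberField IntermediateField

/-- A family of elements of an additive monoid has no vanishing subsum if the sum over
every nonempty (finite) subset of indices is nonzero. -/
def NoVanishingSubsum {ι R : Type*} [AddCommMonoid R] (w : ι → R) : Prop :=
  ∀ I : Finset ι, I.Nonempty → ∑ i ∈ I, w i ≠ 0

/-- The real embedding of the ring of integers of a subfield of `ℝ`. -/
noncomputable def emb (L : IntermediateField ℚ ℝ) (x : 𝓞 L) : ℝ := ((x : L) : ℝ)

/-- The counting function `T_{L,ℓ}^c(X)`: the number of tuples `(u₁, …, u_ℓ)` of units
with `|Tr(c₁u₁) + ⋯ + Tr(c_ℓu_ℓ)| ≤ X`, such that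
`c₁u₁ + ⋯ + c_ℓu_ℓ + c₁'u₁' + ⋯ + c_ℓ'u_ℓ'` has no vanishing subsum and `|u_i| ≥ 1`. -/
noncomputable def TraceSumCount (L : IntermediateField ℚ ℝ) (σ : L ≃ₐ[ℚ] L) (ℓ : ℕ)
    (c : Fin ℓ → L) (X : ℝ) : ℕ :=
  Set.ncard {u : Fin ℓ → (𝓞 L)ˣ |
    |((∑ i, (c i * ((u i : 𝓞 L) : L) + σ (c i * ((u i : 𝓞 L) : L))) : L) : ℝ)| ≤ X ∧
    NoVanishingSubsum (Sum.elim (fun i : Fin ℓ => c i * ((u i : 𝓞 L) : L))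
      (fun i : Fin ℓ => σ (c i * ((u i : 𝓞 L) : L)))) ∧
    ∀ i, 1 ≤ |(((u i : 𝓞 L) : L) : ℝ)|}

/-- The nonzero elements of a finite set of reals are bounded away from zero. -/
lemma Set.Finite.exists_pos_le_abs {T : Set ℝ} (hT : T.Finite) :
    ∃ δ > 0, ∀ x ∈ T, x ≠ 0 → δ ≤ |x| := by
  have hopen : IsOpen (T \ {0})ᶜ := (hT.subset Set.sdiff_subset).isClosed.isOpen_compl
  obtain ⟨δ, hδ, hball⟩ := Metric.isOpen_iff.1 hopen 0 (by simp)
  refine ⟨δ, hδ, fun x hx hx0 => ?_⟩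
  by_contra! hlt
  have hmem : x ∈ Metric.ball (0 : ℝ) δ := by simpa [Real.dist_eq] using hlt
  exact hball hmem ⟨hx, hx0⟩

section Finiteness

variable {G ι : Type*} [CommGroup G] [Fintype ι] (a : G →* ℝ)

lemma exists_pos_le_abs_sum
    (hfin : ∀ D : ℝ, {g : G | |a g| ≤ D ∧ 1 ≤ D * |a g|}.Finite) (c : ι → ℝ) (D : ℝ) :
    ∃ δ > 0, ∀ (I : Finset ι) (w : ι → G), (∀ i ∈ I, |a (w i)| ≤ D ∧ 1 ≤ D * |a (w i)|) →
      ∑ i ∈ I, c i * a (w i) ≠ 0 → δ ≤ |∑ i ∈ I, c i * a (w i)| := by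
  classical
  have hpi : (Set.univ.pi fun _ : ι =>
      insert 1 {g : G | |a g| ≤ D ∧ 1 ≤ D * |a g|}).Finite :=
    Set.Finite.pi fun _ => (hfin D).insert 1
  have hT : (⋃ I : Finset ι, (fun w : ι → G => ∑ i ∈ I, c i * a (w i)) ''
      (Set.univ.pi fun _ : ι => insert 1 {g : G | |a g| ≤ D ∧ 1 ≤ D * |a g|})).Finite :=
    Set.finite_iUnion fun I => hpi.image _
  obtain ⟨δ, hδ, hle⟩ := hT.exists_pos_le_abs
  refine ⟨δ, hδ, fun I w hw => hle _ ?_⟩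
  refine Set.mem_iUnion.2 ⟨I, fun i => if i ∈ I then w i else 1, fun i _ => ?_, ?_⟩
  · by_cases hi : i ∈ I
    · simpa [hi] using Or.inr (hw i hi)
    · simp [hi]
  · exact Finset.sum_congr rfl fun i hi => by simp [hi]

/-- Nondegenerate linear forms in a discrete group of real numbers of size at least one
take bounded values only finitely often. -/
theorem finite_of_abs_sum_le [Nonempty ι]
    (hfin : ∀ D : ℝ, {g : G | |a g| ≤ D ∧ 1 ≤ D * |a g|}.Finite) (c : ι → ℝ) (X : ℝ) :
    {u : ι → G | (∀ i, 1 ≤ |a (u i)|) ∧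
      (∀ I : Finset ι, I.Nonempty → ∑ i ∈ I, c i * a (u i) ≠ 0) ∧
      |∑ i, c i * a (u i)| ≤ X}.Finite := by
  classical
  set S := {u : ι → G | (∀ i, 1 ≤ |a (u i)|) ∧
      (∀ I : Finset ι, I.Nonempty → ∑ i ∈ I, c i * a (u i) ≠ 0) ∧
      |∑ i, c i * a (u i)| ≤ X} with hS
  have key : ∀ k : ℕ, ∃ D : ℝ, 1 ≤ D ∧ ∀ u ∈ S, ∀ i₀, (∀ i, |a (u i)| ≤ |a (u i₀)|) →
      |a (u i₀)| ≤ D ∨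
        ∃ I : Finset ι, i₀ ∈ I ∧ k ≤ I.card ∧ ∀ i ∈ I, |a (u i₀)| ≤ D * |a (u i)| := by
    intro k
    induction k with
    | zero =>
      exact ⟨1, le_rfl, fun u _ i₀ _ => Or.inr ⟨{i₀}, by simp, by simp, by simp⟩⟩
    | succ k ih =>
      obtain ⟨D, hD, hk⟩ := ih
      obtain ⟨δ, hδ, hle⟩ := exists_pos_le_abs_sum a hfin c D
      set K := ∑ i, |c i| with hK
      have hK0 : 0 ≤ K := Finset.sum_nonneg fun i _ => abs_nonneg _
      have hX' : 0 ≤ 2 * |X| / δ := by positivity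
      have hK' : 0 ≤ 2 * K / δ := by positivity
      refine ⟨D + 2 * |X| / δ + 2 * K / δ, by linarith, fun u hu i₀ hmax => ?_⟩
      have hpos : ∀ i, 0 < |a (u i)| := fun i => one_pos.trans_le (hu.1 i)
      rcases hk u hu i₀ hmax with h | ⟨I, hi₀, hcard, hI⟩
      · exact Or.inl (by linarith)
      by_cases hex : ∃ i ∉ I, |a (u i₀)| ≤ (D + 2 * |X| / δ + 2 * K / δ) * |a (u i)|
      · obtain ⟨i, hi, hiD⟩ := hex
        refine Or.inr ⟨insert i I, Finset.mem_insert_of_mem hi₀, ?_, fun j hj => ?_⟩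
        · rw [Finset.card_insert_of_notMem hi]; omega
        · rcases Finset.mem_insert.1 hj with rfl | hj
          · exact hiD
          · refine (hI j hj).trans (mul_le_mul_of_nonneg_right (by linarith) (abs_nonneg _))
      · push Not at hex
        left
        set M := |a (u i₀)| with hM
        have hM0 : 0 < M := hpos i₀
        have ha0 : a (u i₀) ≠ 0 := abs_pos.1 hM0
        have hdiv : ∀ i, a (u i / u i₀) = a (u i) / a (u i₀) := fun i => by
          rw [eq_div_iff ha0, ← map_mul, div_mul_cancel]
        have hsum : ∑ i ∈ I, c i * a (u i / u i₀) = (∑ i ∈ I, c i * a (u i)) / a (u i₀) := by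
          rw [Finset.sum_div]
          exact Finset.sum_congr rfl fun i _ => by rw [hdiv, mul_div_assoc]
        have hlow : δ * M ≤ |∑ i ∈ I, c i * a (u i)| := by
          have h := hle I (fun i => u i / u i₀) (fun i hi => ?_) ?_
          · rwa [hsum, abs_div, le_div_iff₀ hM0] at h
          · rw [hdiv, abs_div, div_le_iff₀ hM0, ← mul_div_assoc, le_div_iff₀ hM0, one_mul]
            exact ⟨(hmax i).trans (le_mul_of_one_le_left hM0.le hD), hI i hi⟩
          · rw [hsum]
            exact div_ne_zero (hu.2.1 I ⟨i₀, hi₀⟩) ha0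
        have hsplit := Finset.sum_add_sum_compl I fun i => c i * a (u i)
        have hcompl : |∑ i ∈ Iᶜ, c i * a (u i)| ≤ δ * M / 2 := by
          have h1 : ∀ i ∈ Iᶜ, 2 * K / δ * |c i * a (u i)| ≤ |c i| * M := fun i hi => by
            have h := hex i (Finset.mem_compl.1 hi)
            have h2 : 2 * K / δ * |a (u i)| ≤ M :=
              (mul_le_mul_of_nonneg_right (by linarith) (abs_nonneg _)).trans h.le
            rw [abs_mul]
            nlinarith [mul_le_mul_of_nonneg_left h2 (abs_nonneg (c i))]
          have h2 : 2 * K / δ * ∑ i ∈ Iᶜ, |c i * a (u i)| ≤ K * M := by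
            rw [Finset.mul_sum, hK, Finset.sum_mul]
            exact (Finset.sum_le_sum h1).trans
              (Finset.sum_le_univ_sum_of_nonneg fun i => by positivity)
          refine (Finset.abs_sum_le_sum_abs _ _).trans ?_
          rcases hK0.eq_or_lt with h0 | h0
          · have hc0 : ∀ i, c i = 0 := fun i => by
              have := (Finset.sum_eq_zero_iff_of_nonneg fun i _ => abs_nonneg (c i)).1
                (hK ▸ h0.symm) i (Finset.mem_univ i)
              exact abs_eq_zero.1 this
            simp only [hc0, zero_mul, abs_zero, Finset.sum_const_zero]
            positivity
          · rw [div_mul_eq_mul_div, div_le_iff₀ hδ] at h2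
            have h3 : K * (2 * ∑ i ∈ Iᶜ, |c i * a (u i)|) ≤ K * (M * δ) := by linarith
            have := le_of_mul_le_mul_left h3 h0
            linarith
        have hbound : |∑ i ∈ I, c i * a (u i)| ≤ |X| + δ * M / 2 := by
          have h1 : ∑ i ∈ I, c i * a (u i) =
              ∑ i, c i * a (u i) - ∑ i ∈ Iᶜ, c i * a (u i) := by linarith
          rw [h1]
          exact (abs_sub _ _).trans (add_le_add (hu.2.2.trans (le_abs_self X)) hcompl)
        have : M ≤ 2 * |X| / δ := by
          rw [le_div_iff₀ hδ]; nlinarith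
        linarith
  obtain ⟨D, hD, hk⟩ := key (Fintype.card ι + 1)
  refine (Set.Finite.pi fun _ : ι => hfin D).subset fun u hu i _ => ?_
  obtain ⟨i₀, hi₀⟩ := Finite.exists_max fun i => |a (u i)|
  rcases hk u hu i₀ hi₀ with h | ⟨I, -, hcard, -⟩
  · have h1 := hu.1 i
    exact ⟨(hi₀ i).trans h, by nlinarith⟩
  · have := Finset.card_le_univ I
    omega

end Finiteness

/-- A set of tuples from `U` whose fibers in some coordinate direction have at most `m` elements
has at most `m * #U ^ (#ι - 1)` elements. -/
lemma card_filter_piFinset_le {G ι : Type*} [DecidableEq G] [Fintype ι] [DecidableEq ι]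
    (U : Finset G) (P : (ι → G) → Prop) [DecidablePred P] (i : ι) (m : ℕ)
    (hP : ∀ u : ι → G, ∃ T : Finset G, T.card ≤ m ∧ ∀ g, P (Function.update u i g) → g ∈ T) :
    ((Fintype.piFinset fun _ : ι => U).filter P).card ≤ m * U.card ^ (Fintype.card ι - 1) := by
  rcases U.eq_empty_or_nonempty with rfl | ⟨g₀, -⟩
  · have : (Fintype.piFinset fun _ : ι => (∅ : Finset G)) = ∅ :=
      Finset.eq_empty_of_forall_notMem fun u hu => by simpa using Fintype.mem_piFinset.1 hu i
    simp [this]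
  set B := (Fintype.piFinset fun _ : ι => U).filter P
  have h1 : B.card ≤ m * (B.image fun u => Function.update u i g₀).card := by
    refine Finset.card_le_mul_card_image B m fun v _ => ?_
    obtain ⟨T, hT, hmem⟩ := hP v
    refine (Finset.card_le_card_of_injOn (fun u : ι → G => u i) (fun u hu => ?_) ?_).trans hT
    · obtain ⟨hu, hv⟩ := Finset.mem_filter.1 hu
      refine hmem _ ?_
      rw [← hv, Function.update_idem, Function.update_eq_self]
      exact (Finset.mem_filter.1 hu).2
    · intro u hu w hw huw
      have h2 := (Finset.mem_filter.1 hu).2.trans (Finset.mem_filter.1 hw).2.symm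
      funext j
      by_cases hj : j = i
      · rw [hj]; exact huw
      · simpa [hj] using congrFun h2 j
  refine h1.trans (Nat.mul_le_mul_left _ ?_)
  have h2 : (B.image fun u => Function.update u i g₀) ⊆
      Fintype.piFinset (Function.update (fun _ : ι => U) i {g₀}) := by
    intro w hw
    obtain ⟨u, hu, rfl⟩ := Finset.mem_image.1 hw
    have hu' := Fintype.mem_piFinset.1 (Finset.mem_filter.1 hu).1
    refine Fintype.mem_piFinset.2 fun j => ?_
    by_cases hj : j = i
    · subst hj; simp
    · simpa [hj] using hu' j
  refine (Finset.card_le_card h2).trans (le_of_eq ?_)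
  rw [Fintype.card_piFinset, ← Finset.mul_prod_erase _ _ (Finset.mem_univ i)]
  rw [Finset.prod_congr rfl (g := fun _ => U.card)
    fun j hj => by simp [Finset.ne_of_mem_erase hj]]
  simp

section Field

variable {L : IntermediateField ℚ ℝ} {σ : L ≃ₐ[ℚ] L}

/-- A nontrivial automorphism of a field of degree at most two sends a unit to its inverse,
up to sign. -/
lemma unit_mul_conj {d : ℕ} (hL : L = ℚ⟮(Real.sqrt d)⟯) (hσ : σ ≠ AlgEquiv.refl) (v : (𝓞 L)ˣ) :
    ((v : 𝓞 L) : L) * σ ((v : 𝓞 L) : L) = 1 ∨ ((v : 𝓞 L) : L) * σ ((v : 𝓞 L) : L) = -1 := by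
  classical
  have hmonic : (Polynomial.X ^ 2 - Polynomial.C (d : ℚ)).Monic :=
    Polynomial.monic_X_pow_sub_C _ two_ne_zero
  have heval : Polynomial.aeval (Real.sqrt d) (Polynomial.X ^ 2 - Polynomial.C (d : ℚ)) = 0 := by
    simp
  have hint : IsIntegral ℚ (Real.sqrt d) := ⟨_, hmonic, by simp⟩
  have hfd : FiniteDimensional ℚ L := by
    rw [hL]; exact IntermediateField.adjoin.finiteDimensional hint
  have hle : Module.finrank ℚ L ≤ 2 := by
    rw [hL, IntermediateField.adjoin.finrank hint]
    refine (Polynomial.natDegree_le_of_dvd (minpoly.dvd ℚ _ heval) hmonic.ne_zero).trans ?_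
    rw [Polynomial.natDegree_X_pow_sub_C]
  have hsub : ({1, σ} : Finset (L ≃ₐ[ℚ] L)).card = 2 := Finset.card_pair (Ne.symm hσ)
  have hcard : Fintype.card (L ≃ₐ[ℚ] L) ≤ Module.finrank ℚ L := AlgEquiv.card_le
  have hle' := Finset.card_le_univ ({1, σ} : Finset (L ≃ₐ[ℚ] L))
  have huniv : (Finset.univ : Finset (L ≃ₐ[ℚ] L)) = {1, σ} :=
    (Finset.eq_univ_of_card _ (by omega)).symm
  have hgal : IsGalois ℚ L := by
    refine IsGalois.of_card_aut_eq_finrank ℚ L ?_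
    rw [Nat.card_eq_fintype_card]; omega
  have hnf : NumberField L := { }
  have hnorm := Algebra.norm_eq_prod_automorphisms ℚ ((v : 𝓞 L) : L)
  rw [huniv, Finset.prod_pair (show (1 : L ≃ₐ[ℚ] L) ≠ σ from Ne.symm hσ)] at hnorm
  have hunit := NumberField.isUnit_iff_norm.1 v.isUnit
  rw [RingOfIntegers.coe_norm] at hunit
  change _ = ((v : 𝓞 L) : L) * σ ((v : 𝓞 L) : L) at hnorm
  rw [← hnorm]
  rcases (abs_eq zero_le_one).1 hunit with h | h
  · left; rw [h, map_one]
  · right; rw [h, map_neg, map_one]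

variable (L) in
/-- The units of a real field as real numbers. -/
noncomputable def unitReal : (𝓞 L)ˣ →* ℝ :=
  ((algebraMap L ℝ).comp (algebraMap (𝓞 L) L) : 𝓞 L →* ℝ).comp (Units.coeHom (𝓞 L))

lemma unitReal_apply (v : (𝓞 L)ˣ) : unitReal L v = (((v : 𝓞 L) : L) : ℝ) := rfl

lemma unitReal_injective : Function.Injective (unitReal L) := fun u v h => by
  rw [unitReal_apply, unitReal_apply] at h
  exact Units.ext (RingOfIntegers.ext (Subtype.ext h))

lemma unitReal_ne_zero (v : (𝓞 L)ˣ) : unitReal L v ≠ 0 := fun h => by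
  have := map_mul (unitReal L) v v⁻¹
  rw [h] at this
  simp at this

lemma unitReal_neg (v : (𝓞 L)ˣ) : unitReal L (-v) = -unitReal L v := by
  simp [unitReal_apply]

lemma finite_units_abs_le {η : (𝓞 L)ˣ} (hη : 1 < emb L η)
    (hfund : ∀ ε : (𝓞 L)ˣ, 1 < emb L ε → emb L η ≤ emb L ε) (D : ℝ) :
    {v : (𝓞 L)ˣ | |unitReal L v| ≤ D ∧ 1 ≤ D * |unitReal L v|}.Finite := by
  have hη' : 1 < unitReal L η := hη
  have hη0 : 0 < unitReal L η := one_pos.trans hη'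
  obtain ⟨m, hm⟩ := pow_unbounded_of_one_lt D hη'
  refine (((Set.finite_Icc (-(m : ℤ) - 1) m).image fun n : ℤ => η ^ n).union
    ((Set.finite_Icc (-(m : ℤ) - 1) m).image fun n : ℤ => -η ^ n)).subset ?_
  rintro v ⟨hv1, hv2⟩
  have hv0 : 0 < |unitReal L v| := abs_pos.2 (unitReal_ne_zero v)
  obtain ⟨n, hn1, hn2⟩ := exists_mem_Ico_zpow hv0 hη'
  have hnm : n ≤ m := by
    have h := (hn1.trans hv1).trans hm.le
    rw [← zpow_natCast] at h
    exact (zpow_le_zpow_iff_right₀ hη').1 h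
  have hmn : -(m : ℤ) - 1 ≤ n := by
    have h : unitReal L η ^ (0 : ℤ) ≤ unitReal L η ^ ((m : ℤ) + (n + 1)) := by
      rw [zpow_add₀ hη0.ne', zpow_natCast, zpow_zero]
      exact hv2.trans (mul_le_mul hm.le hn2.le hv0.le (by positivity))
    have := (zpow_le_zpow_iff_right₀ hη').1 h
    omega
  have hz : unitReal L (η ^ n) = unitReal L η ^ n := by
    exact map_zpow' (unitReal L) (fun x => by
      refine eq_inv_of_mul_eq_one_left ?_
      rw [← map_mul, inv_mul_cancel, map_one]) η n
  have hle : ∀ w : (𝓞 L)ˣ, unitReal L w = |unitReal L v| → w = η ^ n := by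
    intro w hw
    have hdiv : unitReal L (w / η ^ n) = |unitReal L v| / unitReal L η ^ n := by
      rw [eq_div_iff (zpow_pos hη0 n).ne', ← hz, ← map_mul, div_mul_cancel, hw]
    have hge : 1 ≤ unitReal L (w / η ^ n) := by
      rw [hdiv, one_le_div (zpow_pos hη0 n)]; exact hn1
    have hlt : unitReal L (w / η ^ n) < unitReal L η := by
      rw [hdiv, div_lt_iff₀ (zpow_pos hη0 n), mul_comm, ← zpow_add_one₀ hη0.ne']; exact hn2
    rcases hge.eq_or_lt with h | h
    · exact div_eq_one.1 (unitReal_injective (h.symm.trans (map_one _).symm))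
    · exact absurd (hfund (w / η ^ n) h) (not_le.2 hlt)
  rcases abs_choice (unitReal L v) with h | h
  · exact Or.inl ⟨n, ⟨hmn, hnm⟩, (hle v h.symm).symm⟩
  · refine Or.inr ⟨n, ⟨hmn, hnm⟩, ?_⟩
    have := hle (-v) (by rw [unitReal_neg, h])
    simp only [← this, neg_neg]

/-- A nontrivial linear equation in a unit and its conjugate has at most four solutions. -/
lemma exists_card_le_four
    (hnorm : ∀ v : (𝓞 L)ˣ, ((v : 𝓞 L) : L) * σ ((v : 𝓞 L) : L) = 1 ∨
      ((v : 𝓞 L) : L) * σ ((v : 𝓞 L) : L) = -1) (a b k : L) (hab : a ≠ 0 ∨ b ≠ 0) :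
    ∃ T : Finset (𝓞 L)ˣ, T.card ≤ 4 ∧
      ∀ v : (𝓞 L)ˣ, a * ((v : 𝓞 L) : L) + b * σ ((v : 𝓞 L) : L) = k → v ∈ T := by
  classical
  let p (s : L) : Polynomial L :=
    Polynomial.C a * Polynomial.X ^ 2 + Polynomial.C (-k) * Polynomial.X + Polynomial.C (s * b)
  have hp0 : ∀ s, s ≠ 0 → p s ≠ 0 := by
    intro s hs h
    rcases hab with ha | hb
    · have := congrArg (fun q => Polynomial.coeff q 2) h
      simp [p] at this
      exact ha this
    · have := congrArg (fun q => Polynomial.coeff q 0) h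
      simp [p, Polynomial.coeff_X] at this
      exact this.elim hs hb
  have hcard : ∀ s, (p s).roots.toFinset.card ≤ 2 := fun s =>
    (Multiset.toFinset_card_le _).trans
      ((Polynomial.card_roots' _).trans Polynomial.natDegree_quadratic_le)
  have hinj : Function.Injective fun v : (𝓞 L)ˣ => ((v : 𝓞 L) : L) := fun u v h =>
    Units.ext (RingOfIntegers.ext h)
  refine ⟨((p 1).roots.toFinset ∪ (p (-1)).roots.toFinset).preimage _ hinj.injOn, ?_,
    fun v hv => ?_⟩
  · refine (Finset.card_le_card_of_injOn
      (t := (p 1).roots.toFinset ∪ (p (-1)).roots.toFinset) (fun v : (𝓞 L)ˣ => ((v : 𝓞 L) : L))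
      (fun v hv => by rwa [Finset.coe_preimage] at hv) hinj.injOn).trans
      ((Finset.card_union_le _ _).trans ?_)
    have h1 := hcard 1
    have h2 := hcard (-1)
    omega
  · rw [Finset.mem_preimage, Finset.mem_union, Multiset.mem_toFinset, Multiset.mem_toFinset,
      Polynomial.mem_roots (hp0 1 one_ne_zero), Polynomial.mem_roots (hp0 (-1) (by simp))]
    refine (hnorm v).imp (fun h => ?_) (fun h => ?_) <;>
    · simp only [Polynomial.IsRoot.def, p, Polynomial.eval_add, Polynomial.eval_mul,
        Polynomial.eval_C, Polynomial.eval_pow, Polynomial.eval_X]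
      rw [← hv]
      linear_combination (-b) * h

/-- For a fixed set of indices, the vanishing of the corresponding subsum leaves at most four
choices for one of the coordinates. -/
lemma exists_coord_card_le_four
    (hnorm : ∀ v : (𝓞 L)ˣ, ((v : 𝓞 L) : L) * σ ((v : 𝓞 L) : L) = 1 ∨
      ((v : 𝓞 L) : L) * σ ((v : 𝓞 L) : L) = -1)
    {ι : Type*} [Fintype ι] [DecidableEq ι] {c : ι → L} (hc : ∀ i, c i ≠ 0)
    {I : Finset (ι ⊕ ι)} (hI : I.Nonempty) :
    ∃ i : ι, ∀ u : ι → (𝓞 L)ˣ, ∃ T : Finset (𝓞 L)ˣ, T.card ≤ 4 ∧ ∀ g,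
      ∑ x ∈ I, Sum.elim (fun j => c j * ((Function.update u i g j : 𝓞 L) : L))
        (fun j => σ (c j * ((Function.update u i g j : 𝓞 L) : L))) x = 0 → g ∈ T := by
  let A (j : ι) : L := if Sum.inl j ∈ I then c j else 0
  let B (j : ι) : L := if Sum.inr j ∈ I then σ (c j) else 0
  have hsum : ∀ u : ι → (𝓞 L)ˣ, ∑ x ∈ I, Sum.elim (fun j => c j * ((u j : 𝓞 L) : L))
      (fun j => σ (c j * ((u j : 𝓞 L) : L))) x =
      ∑ j, (A j * ((u j : 𝓞 L) : L) + B j * σ ((u j : 𝓞 L) : L)) := by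
    intro u
    rw [← Finset.filter_univ_mem I, Finset.sum_filter, Fintype.sum_sum_type,
      ← Finset.sum_add_distrib]
    refine Finset.sum_congr rfl fun j _ => ?_
    simp [A, B, ite_mul, map_mul]
  obtain ⟨i, hi⟩ : ∃ i, A i ≠ 0 ∨ B i ≠ 0 := by
    obtain ⟨x | x, hx⟩ := hI
    · exact ⟨x, Or.inl (by simp [A, hx, hc])⟩
    · exact ⟨x, Or.inr (by simp [B, hx, hc])⟩
  refine ⟨i, fun u => ?_⟩
  obtain ⟨T, hT, hmem⟩ := exists_card_le_four hnorm (A i) (B i)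
    (-∑ j ∈ Finset.univ.erase i, (A j * ((u j : 𝓞 L) : L) + B j * σ ((u j : 𝓞 L) : L))) hi
  refine ⟨T, hT, fun g hg => hmem g ?_⟩
  rw [hsum, ← Finset.add_sum_erase _ _ (Finset.mem_univ i), Function.update_self] at hg
  rw [Finset.sum_congr rfl (g := fun j => A j * ((u j : 𝓞 L) : L) + B j * σ ((u j : 𝓞 L) : L))
    fun j hj => by rw [Function.update_of_ne (Finset.ne_of_mem_erase hj)]] at hg
  exact eq_neg_of_add_eq_zero_left hg

lemma exists_finset_units {η : (𝓞 L)ˣ} (hη : 1 < unitReal L η) (N : ℕ) :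
    ∃ U : Finset (𝓞 L)ˣ, U.card = 2 * (N + 1) ∧
      ∀ v ∈ U, 1 ≤ |unitReal L v| ∧ |unitReal L v| ≤ unitReal L η ^ N := by
  classical
  have hη0 : 0 < unitReal L η := one_pos.trans hη
  have hinj : Function.Injective fun n : ℕ => η ^ n := fun m n h => by
    have := congrArg (unitReal L) h
    simp only [map_pow] at this
    exact pow_right_injective₀ hη0 hη.ne' this
  refine ⟨(Finset.range (N + 1)).image (fun n => η ^ n) ∪
    (Finset.range (N + 1)).image (fun n => -η ^ n), ?_, fun v hv => ?_⟩
  · rw [Finset.card_union_of_disjoint, Finset.card_image_of_injective _ hinj,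
      Finset.card_image_of_injective _ (f := fun n => -η ^ n) (neg_injective.comp hinj),
      Finset.card_range, two_mul]
    rw [Finset.disjoint_left]
    intro v hv hv'
    obtain ⟨m, -, rfl⟩ := Finset.mem_image.1 hv
    obtain ⟨n, -, h⟩ := Finset.mem_image.1 hv'
    have := congrArg (unitReal L) h
    simp only [unitReal_neg, map_pow] at this
    linarith [pow_pos hη0 m, pow_pos hη0 n]
  · obtain ⟨n, hn, habs⟩ : ∃ n < N + 1, |unitReal L v| = unitReal L η ^ n := by
      rcases Finset.mem_union.1 hv with hv | hv <;>
      obtain ⟨n, hn, rfl⟩ := Finset.mem_image.1 hv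
      · exact ⟨n, Finset.mem_range.1 hn, by rw [map_pow, abs_of_pos (pow_pos hη0 n)]⟩
      · refine ⟨n, Finset.mem_range.1 hn, ?_⟩
        rw [unitReal_neg, map_pow, abs_neg, abs_of_pos (pow_pos hη0 n)]
    rw [habs]
    exact ⟨one_le_pow₀ hη.le, pow_le_pow_right₀ hη.le (by omega)⟩

lemma abs_conj_le_one
    (hnorm : ∀ v : (𝓞 L)ˣ, ((v : 𝓞 L) : L) * σ ((v : 𝓞 L) : L) = 1 ∨
      ((v : 𝓞 L) : L) * σ ((v : 𝓞 L) : L) = -1) {v : (𝓞 L)ˣ} (hv : 1 ≤ |unitReal L v|) :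
    |((σ ((v : 𝓞 L) : L) : L) : ℝ)| ≤ 1 := by
  have h : |unitReal L v| * |((σ ((v : 𝓞 L) : L) : L) : ℝ)| = 1 := by
    rw [← abs_mul, unitReal_apply]
    rcases hnorm v with h | h
    · rw [← MulMemClass.coe_mul, h]; simp
    · rw [← MulMemClass.coe_mul, h]; simp
  nlinarith [abs_nonneg ((σ ((v : 𝓞 L) : L) : L) : ℝ)]

lemma coe_sum_add_conj {ι : Type*} [Fintype ι] (c : ι → L) (u : ι → (𝓞 L)ˣ) :
    ((∑ i, (c i * ((u i : 𝓞 L) : L) + σ (c i * ((u i : 𝓞 L) : L))) : L) : ℝ) =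
      ∑ i, (c i : ℝ) * unitReal L (u i) +
        ∑ i, ((σ (c i) : L) : ℝ) * ((σ ((u i : 𝓞 L) : L) : L) : ℝ) := by
  rw [← Finset.sum_add_distrib, ← IntermediateField.algebraMap_apply, map_sum]
  refine Finset.sum_congr rfl fun i _ => ?_
  rw [map_add, map_mul, map_mul, map_mul]
  rfl

lemma abs_sum_conj_le
    (hnorm : ∀ v : (𝓞 L)ˣ, ((v : 𝓞 L) : L) * σ ((v : 𝓞 L) : L) = 1 ∨
      ((v : 𝓞 L) : L) * σ ((v : 𝓞 L) : L) = -1) {ι : Type*} [Fintype ι] (c : ι → L)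
    {u : ι → (𝓞 L)ˣ} (hu : ∀ i, 1 ≤ |unitReal L (u i)|) :
    |∑ i, ((σ (c i) : L) : ℝ) * ((σ ((u i : 𝓞 L) : L) : L) : ℝ)| ≤
      ∑ i, |((σ (c i) : L) : ℝ)| := by
  refine (Finset.abs_sum_le_sum_abs _ _).trans (Finset.sum_le_sum fun i _ => ?_)
  rw [abs_mul]
  exact mul_le_of_le_one_right (abs_nonneg _) (abs_conj_le_one hnorm (hu i))

/-- The set counted by `TraceSumCount` is finite. -/
lemma finite_traceSum_set
    (hnorm : ∀ v : (𝓞 L)ˣ, ((v : 𝓞 L) : L) * σ ((v : 𝓞 L) : L) = 1 ∨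
      ((v : 𝓞 L) : L) * σ ((v : 𝓞 L) : L) = -1) {η : (𝓞 L)ˣ} (hη : 1 < emb L η)
    (hfund : ∀ ε : (𝓞 L)ˣ, 1 < emb L ε → emb L η ≤ emb L ε)
    {ι : Type*} [Fintype ι] [Nonempty ι] (c : ι → L) (X : ℝ) :
    {u : ι → (𝓞 L)ˣ |
      |((∑ i, (c i * ((u i : 𝓞 L) : L) + σ (c i * ((u i : 𝓞 L) : L))) : L) : ℝ)| ≤ X ∧
      NoVanishingSubsum (Sum.elim (fun i : ι => c i * ((u i : 𝓞 L) : L))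
        (fun i : ι => σ (c i * ((u i : 𝓞 L) : L)))) ∧
      ∀ i, 1 ≤ |(((u i : 𝓞 L) : L) : ℝ)|}.Finite := by
  refine (finite_of_abs_sum_le (unitReal L) (finite_units_abs_le hη hfund)
    (fun i => (c i : ℝ)) (X + ∑ i, |((σ (c i) : L) : ℝ)|)).subset ?_
  rintro u ⟨hX, hvan, hu⟩
  refine ⟨hu, fun I hI h0 => ?_, ?_⟩
  · refine hvan (I.map Function.Embedding.inl) (hI.map) ?_
    rw [Finset.sum_map]
    refine Subtype.ext ?_
    rw [← IntermediateField.algebraMap_apply, map_sum]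
    simpa [unitReal_apply] using h0
  · rw [coe_sum_add_conj] at hX
    have h1 := abs_sum_conj_le hnorm c hu
    rw [abs_le] at *
    constructor <;> linarith [hX.1, hX.2, h1.1, h1.2]

lemma le_traceSumCount
    (hnorm : ∀ v : (𝓞 L)ˣ, ((v : 𝓞 L) : L) * σ ((v : 𝓞 L) : L) = 1 ∨
      ((v : 𝓞 L) : L) * σ ((v : 𝓞 L) : L) = -1) {η : (𝓞 L)ˣ} (hη : 1 < emb L η)
    (hfund : ∀ ε : (𝓞 L)ˣ, 1 < emb L ε → emb L η ≤ emb L ε)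
    {ℓ : ℕ} (hℓ : 1 ≤ ℓ) {c : Fin ℓ → L} (hc : ∀ i, c i ≠ 0) {X : ℝ} {N : ℕ}
    (hX : (∑ i, |(c i : ℝ)| + ∑ i, |((σ (c i) : L) : ℝ)|) * emb L η ^ N ≤ X) :
    (2 * (N + 1)) ^ ℓ ≤ TraceSumCount L σ ℓ c X +
      Fintype.card (Finset (Fin ℓ ⊕ Fin ℓ)) * (4 * (2 * (N + 1)) ^ (ℓ - 1)) := by
  classical
  have : Nonempty (Fin ℓ) := ⟨⟨0, hℓ⟩⟩
  obtain ⟨U, hcard, hU⟩ := exists_finset_units (L := L) (η := η) hη N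
  set P := Fintype.piFinset fun _ : Fin ℓ => U with hP
  have hPcard : P.card = (2 * (N + 1)) ^ ℓ := by simp [hP, hcard]
  let V (u : Fin ℓ → (𝓞 L)ˣ) : Prop :=
    NoVanishingSubsum (Sum.elim (fun i : Fin ℓ => c i * ((u i : 𝓞 L) : L))
        (fun i : Fin ℓ => σ (c i * ((u i : 𝓞 L) : L))))
  have hgood : (P.filter V).card ≤ TraceSumCount L σ ℓ c X := by
    rw [TraceSumCount, ← Set.ncard_coe_finset]
    refine Set.ncard_le_ncard (fun u hu => ?_) (finite_traceSum_set hnorm hη hfund c X)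
    obtain ⟨hu, hV⟩ := Finset.mem_filter.1 (Finset.mem_coe.1 hu)
    have hu := fun i => hU _ (Fintype.mem_piFinset.1 hu i)
    refine ⟨?_, hV, fun i => (hu i).1⟩
    rw [coe_sum_add_conj]
    refine (abs_add_le _ _).trans (le_trans ?_ hX)
    have h1 : |∑ i, (c i : ℝ) * unitReal L (u i)| ≤ (∑ i, |(c i : ℝ)|) * emb L η ^ N := by
      refine (Finset.abs_sum_le_sum_abs _ _).trans ?_
      rw [Finset.sum_mul]
      refine Finset.sum_le_sum fun i _ => ?_
      rw [abs_mul]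
      exact mul_le_mul_of_nonneg_left (hu i).2 (abs_nonneg _)
    have h2 := abs_sum_conj_le hnorm c (fun i => (hu i).1)
    have h3 : ∑ i, |((σ (c i) : L) : ℝ)| ≤ (∑ i, |((σ (c i) : L) : ℝ)|) * emb L η ^ N :=
      le_mul_of_one_le_right (Finset.sum_nonneg fun i _ => abs_nonneg _) (one_le_pow₀ hη.le)
    rw [add_mul]
    linarith
  have hbad : (P.filter fun u => ¬ V u).card ≤
      Fintype.card (Finset (Fin ℓ ⊕ Fin ℓ)) * (4 * (2 * (N + 1)) ^ (ℓ - 1)) := by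
    let Q (I : Finset (Fin ℓ ⊕ Fin ℓ)) (u : Fin ℓ → (𝓞 L)ˣ) : Prop := I.Nonempty ∧
      ∑ x ∈ I, Sum.elim (fun i : Fin ℓ => c i * ((u i : 𝓞 L) : L))
        (fun i : Fin ℓ => σ (c i * ((u i : 𝓞 L) : L))) x = 0
    have hsub : (P.filter fun u => ¬ V u) ⊆
        Finset.univ.biUnion fun I => P.filter (Q I) := by
      intro u hu
      obtain ⟨hu, hV⟩ := Finset.mem_filter.1 hu
      simp only [V, NoVanishingSubsum, not_forall, not_not] at hV
      obtain ⟨I, hI, h0⟩ := hV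
      exact Finset.mem_biUnion.2 ⟨I, Finset.mem_univ _, Finset.mem_filter.2 ⟨hu, hI, h0⟩⟩
    refine (Finset.card_le_card hsub).trans (Finset.card_biUnion_le_card_mul _ _ _ fun I _ => ?_)
    rcases I.eq_empty_or_nonempty with rfl | hI
    · simp [Q]
    obtain ⟨i, hi⟩ := exists_coord_card_le_four hnorm hc hI
    have := card_filter_piFinset_le U (Q I) i 4 fun u => by
      obtain ⟨T, hT, hmem⟩ := hi u
      exact ⟨T, hT, fun g hg => hmem g hg.2⟩
    rwa [hcard, Fintype.card_fin] at this
  have := Finset.card_filter_add_card_filter_not (s := P) V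
  omega

end Field

/-- Lemma 10: the lower bound
`T_{L,ℓ}^c(X) ≥ (2 log X / log η)^ℓ + O((log X)^{ℓ-1})`. -/
theorem trace_sum_count_lower_bound
    (d : ℕ) (hd : 2 ≤ d) (hsf : Squarefree d)
    (L : IntermediateField ℚ ℝ) (hL : L = ℚ⟮(Real.sqrt d)⟯)
    (σ : L ≃ₐ[ℚ] L) (hσ : σ ≠ AlgEquiv.refl)
    (η : (𝓞 L)ˣ) (hη : 1 < emb L η)
    (hfund : ∀ ε : (𝓞 L)ˣ, 1 < emb L ε → emb L η ≤ emb L ε)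
    (ℓ : ℕ) (hℓ : 1 ≤ ℓ) (c : Fin ℓ → L) (hc : ∀ i, c i ≠ 0) :
    ∃ C : ℝ, 0 < C ∧ ∀ X : ℝ, 2 ≤ X →
      (2 * Real.log X / Real.log (emb L η)) ^ ℓ - C * Real.log X ^ (ℓ - 1)
        ≤ (TraceSumCount L σ ℓ c X : ℝ) := by
  have hnorm := unit_mul_conj hL hσ
  set lam := Real.log (emb L η)
  have hlam : 0 < lam := Real.log_pos hη
  have hη0 : 0 < emb L η := one_pos.trans hη
  have hlog2 : 0 < Real.log 2 := Real.log_pos one_lt_two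
  set K := ∑ i, |(c i : ℝ)| + ∑ i, |((σ (c i) : L) : ℝ)| + 1 with hK
  have hK1 : 1 ≤ K := by
    have h1 : 0 ≤ ∑ i, |(c i : ℝ)| := Finset.sum_nonneg fun i _ => abs_nonneg _
    have h2 : 0 ≤ ∑ i, |((σ (c i) : L) : ℝ)| := Finset.sum_nonneg fun i _ => abs_nonneg _
    linarith
  have hK0 : 0 < K := one_pos.trans_le hK1
  have hlogK : 0 ≤ Real.log K := Real.log_nonneg hK1
  set W : ℝ := (Fintype.card (Finset (Fin ℓ ⊕ Fin ℓ)) : ℝ)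
  set B : ℝ := 2 / lam + 2 / Real.log 2 with hB
  have hB0 : 0 < B := by positivity
  set A : ℝ := 2 * Real.log K / lam + 2 with hA
  have hA0 : 0 < A := by positivity
  refine ⟨(2 / lam) ^ ℓ * Real.log K + A * ℓ * B ^ (ℓ - 1) + W * (4 * B ^ (ℓ - 1)) + 1,
    by positivity, fun X hX => ?_⟩
  have hX0 : 0 < X := by linarith
  set Y := Real.log X with hY
  have hY2 : Real.log 2 ≤ Y := Real.log_le_log two_pos hX
  have hY0 : 0 < Y := hlog2.trans_le hY2
  have hYp : 0 < Y ^ (ℓ - 1) := pow_pos hY0 _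
  have hT0 : (0 : ℝ) ≤ (TraceSumCount L σ ℓ c X : ℝ) := Nat.cast_nonneg _
  have ht1 : 0 ≤ (2 / lam) ^ ℓ * Real.log K * Y ^ (ℓ - 1) := by positivity
  have ht2 : 0 ≤ A * ℓ * B ^ (ℓ - 1) * Y ^ (ℓ - 1) := by positivity
  have ht3 : 0 ≤ W * (4 * B ^ (ℓ - 1)) * Y ^ (ℓ - 1) := by positivity
  rcases lt_or_ge X K with hXK | hXK
  · have hYK : Y ≤ Real.log K := Real.log_le_log hX0 hXK.le
    have h1 : (2 * Y / lam) ^ ℓ ≤ (2 / lam) ^ ℓ * Real.log K * Y ^ (ℓ - 1) := by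
      rw [mul_div_right_comm, mul_pow, mul_assoc]
      refine mul_le_mul_of_nonneg_left ?_ (by positivity)
      calc Y ^ ℓ = Y * Y ^ (ℓ - 1) := by rw [← pow_succ', Nat.sub_add_cancel hℓ]
        _ ≤ _ := mul_le_mul_of_nonneg_right hYK hYp.le
    linarith
  · have hYK : Real.log K ≤ Y := Real.log_le_log hK0 hXK
    set N := ⌊(Y - Real.log K) / lam⌋₊ with hN
    have hN0 : 0 ≤ (Y - Real.log K) / lam := div_nonneg (by linarith) hlam.le
    have hN1 : (N : ℝ) ≤ (Y - Real.log K) / lam := Nat.floor_le hN0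
    have hN2 : (Y - Real.log K) / lam < N + 1 := Nat.lt_floor_add_one _
    have hbd : K * emb L η ^ N ≤ X := by
      rw [← Real.log_le_log_iff (by positivity) hX0, Real.log_mul hK0.ne' (by positivity),
        Real.log_pow]
      rw [le_div_iff₀ hlam] at hN1
      linarith
    have hcount := le_traceSumCount hnorm hη hfund hℓ hc (N := N) (X := X)
      (le_trans (mul_le_mul_of_nonneg_right (by linarith) (by positivity)) hbd)
    have hcount' : (2 * ((N : ℝ) + 1)) ^ ℓ ≤ (TraceSumCount L σ ℓ c X : ℝ) +
        W * (4 * (2 * ((N : ℝ) + 1)) ^ (ℓ - 1)) := by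
      have h := (Nat.cast_le (α := ℝ)).2 hcount
      push_cast at h
      exact h
    have hsub : (Y - Real.log K) / lam = Y / lam - Real.log K / lam := sub_div _ _ _
    have hKl : 0 ≤ Real.log K / lam := by positivity
    have hA' : A = 2 * (Real.log K / lam) + 2 := by rw [hA]; ring
    have ha' : 2 * Y / lam = 2 * (Y / lam) := mul_div_assoc _ _ _
    have hY1 : 1 ≤ Y / Real.log 2 := (one_le_div hlog2).2 hY2
    have hBY : B * Y = 2 * (Y / lam) + 2 * (Y / Real.log 2) := by rw [hB]; ring
    have hYl : 0 ≤ Y / lam := by positivity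
    have hM0 : (0 : ℝ) ≤ 2 * ((N : ℝ) + 1) := by positivity
    have hMB : 2 * ((N : ℝ) + 1) ≤ B * Y := by rw [hBY]; linarith
    have hpow : (2 * ((N : ℝ) + 1)) ^ (ℓ - 1) ≤ B ^ (ℓ - 1) * Y ^ (ℓ - 1) := by
      rw [← mul_pow]; exact pow_le_pow_left₀ hM0 hMB _
    have hdiff : (2 * Y / lam) ^ ℓ - (2 * ((N : ℝ) + 1)) ^ ℓ ≤
        A * ℓ * B ^ (ℓ - 1) * Y ^ (ℓ - 1) := by
      refine (le_abs_self _).trans ((abs_pow_sub_pow_le _ _ _).trans ?_)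
      rw [mul_assoc (A * ℓ), ← mul_pow]
      refine mul_le_mul (mul_le_mul_of_nonneg_right ?_ (by positivity)) ?_ (by positivity)
        (by positivity)
      · rw [ha', abs_le]; constructor <;> linarith
      · refine pow_le_pow_left₀ (by positivity) (max_le ?_ ?_) _
        · rw [ha', abs_of_nonneg (by positivity), hBY]; linarith
        · rw [abs_of_nonneg hM0]; exact hMB
    have hW : W * (4 * (2 * ((N : ℝ) + 1)) ^ (ℓ - 1)) ≤ W * (4 * B ^ (ℓ - 1)) * Y ^ (ℓ - 1) := by
      rw [mul_assoc W, mul_assoc 4]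
      exact mul_le_mul_of_nonneg_left (by linarith) (by positivity)
    linarith
end

section
/- Let L = ℚ(√d) be a real quadratic field (d ≥ 2 squarefree, embedded in ℝ with √d > 0), let k ∈ ℕ and ρ = ⌊k/2⌋. Define 𝒯_{k,ρ}(X) to be the set of tuples u = (v, v', ξ) where v ∈ (O_L^×)^ρ with |v_i| ≥ 1 for all i, v' is the coordinatewise Galois conjugate of v, ξ is the empty tuple when k is even, and ξ is either the empty tuple or one of the one-entry tuples (1), (−1) when k is odd, such that the sum S_u of the coordinates of u lies in ℤ, has no vanishing subsum, and satisfies |S_u| ≤ X. Call two tuples equivalent if one arises from the other by a permutation of its coordinates (in particular they have the same length), and let ℰ_k(X) be the set of u ∈ 𝒯_{k,ρ}(X) for which there exists ũ ∈ 𝒯_{k,ρ}(X) not equivalent to u with S_ũ = S_u. Then #ℰ_k(X) ≪_{k,L} (log X)^{ρ−1} for X ≥ 2. -/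
open NumberField IntermediateField

/-- Two finite tuples are equivalent if one arises from the other by permuting
coordinates (in particular they have the same length). -/
def TupleEquiv {α : Type*} (u w : (m : ℕ) × (Fin m → α)) : Prop :=
  ∃ π : Fin w.1 ≃ Fin u.1, w.2 = u.2 ∘ π

/-- The tuple `(v, v')` of shape `(S₁)`. -/
noncomputable def shapeS1 (L : IntermediateField ℚ ℝ) (σ : L ≃ₐ[ℚ] L) (ρ : ℕ)
    (v : Fin ρ → (𝓞 L)ˣ) : (m : ℕ) × (Fin m → L) :=
  ⟨ρ + ρ, Fin.append (fun i => ((v i : 𝓞 L) : L)) (fun i => σ ((v i : 𝓞 L) : L))⟩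

/-- The tuple `(v, v', 1)` of shape `(S₂)`. -/
noncomputable def shapeS2 (L : IntermediateField ℚ ℝ) (σ : L ≃ₐ[ℚ] L) (ρ : ℕ)
    (v : Fin ρ → (𝓞 L)ˣ) : (m : ℕ) × (Fin m → L) :=
  ⟨ρ + ρ + 1, Fin.append (Fin.append (fun i => ((v i : 𝓞 L) : L))
    (fun i => σ ((v i : 𝓞 L) : L))) (fun _ : Fin 1 => (1 : L))⟩

/-- The tuple `(v, v', -1)` of shape `(S₃)`. -/
noncomputable def shapeS3 (L : IntermediateField ℚ ℝ) (σ : L ≃ₐ[ℚ] L) (ρ : ℕ)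
    (v : Fin ρ → (𝓞 L)ˣ) : (m : ℕ) × (Fin m → L) :=
  ⟨ρ + ρ + 1, Fin.append (Fin.append (fun i => ((v i : 𝓞 L) : L))
    (fun i => σ ((v i : 𝓞 L) : L))) (fun _ : Fin 1 => (-1 : L))⟩

/-- The set `𝒯_{k,ρ}(X)` of tuples `u = (v, v', ξ)` (with `ξ` empty for even `k`, and
empty, `(1)` or `(-1)` for odd `k`), with `|v_i| ≥ 1`, whose coordinate sum is an
integer with no vanishing subsum and of absolute value at most `X`. -/
noncomputable def TSet (L : IntermediateField ℚ ℝ) (σ : L ≃ₐ[ℚ] L) (k : ℕ) (X : ℝ) :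
    Set ((m : ℕ) × (Fin m → L)) :=
  {u | (∃ v : Fin (k / 2) → (𝓞 L)ˣ, (∀ i, 1 ≤ |(((v i : 𝓞 L) : L) : ℝ)|) ∧
      (u = shapeS1 L σ (k / 2) v ∨
        (Odd k ∧ (u = shapeS2 L σ (k / 2) v ∨ u = shapeS3 L σ (k / 2) v)))) ∧
    (∃ z : ℤ, (∑ i, u.2 i) = (z : L)) ∧
    NoVanishingSubsum u.2 ∧
    |((∑ i, u.2 i : L) : ℝ)| ≤ X}

/-- The elements of `U` whose absolute value lies in `[K⁻¹, K]`. -/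
def annulus (U : Subgroup ℝˣ) (K : ℝ) : Set ℝˣ :=
  {t | t ∈ U ∧ |(t : ℝ)| ≤ K ∧ |((t⁻¹ : ℝˣ) : ℝ)| ≤ K}

theorem Set.Finite.exists_pos_forall_le {s : Set ℝ} (hs : s.Finite) (hpos : ∀ y ∈ s, 0 < y) :
    ∃ c : ℝ, 0 < c ∧ ∀ y ∈ s, c ≤ y := by
  rcases s.eq_empty_or_nonempty with rfl | hne
  · exact ⟨1, one_pos, by simp⟩
  · obtain ⟨c, hc, hmin⟩ := hs.exists_minimalFor id s hne
    refine ⟨c, hpos c hc, fun y hy => ?_⟩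
    by_contra! h
    exact absurd (hmin hy h.le) (not_le.mpr h)

/-- A sum of units without vanishing subsums is at least a constant times its largest term. -/
theorem exists_mul_abs_le_abs_sum {U : Subgroup ℝˣ} (hU : ∀ K, (annulus U K).Finite)
    (ι : Type*) [Finite ι] (n : ℕ) :
    ∃ c : ℝ, 0 < c ∧ ∀ s : Finset ι, s.card ≤ n → ∀ x : ι → ℝˣ, (∀ i, x i ∈ U) →
      (∀ I ⊆ s, I.Nonempty → ∑ i ∈ I, (x i : ℝ) ≠ 0) →
      ∀ i ∈ s, c * |(x i : ℝ)| ≤ |∑ i ∈ s, (x i : ℝ)| := by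
  classical
  induction n with
  | zero =>
    refine ⟨1, one_pos, fun s hs x _ _ i hi => ?_⟩
    simp only [nonpos_iff_eq_zero, Finset.card_eq_zero] at hs
    simp [hs] at hi
  | succ n ih =>
    obtain ⟨c, hc, ih⟩ := ih
    set K : ℝ := max 1 (2 / c) with hK
    have hV : {y : ℝ | y ≠ 0 ∧ ∃ s : Finset ι, ∃ f ∈ Set.pi Set.univ (fun _ : ι => annulus U K),
        y = ∑ i ∈ s, (f i : ℝ)}.Finite := by
      refine Set.Finite.subset ((Set.finite_univ (α := Finset ι)).prod
        (Set.Finite.pi' (fun _ : ι => hU K)) |>.image (fun p => ∑ i ∈ p.1, (p.2 i : ℝ))) ?_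
      rintro y ⟨-, s, f, hf, rfl⟩
      exact ⟨(s, f), ⟨Set.mem_univ _, fun i => hf i (Set.mem_univ _)⟩, rfl⟩
    obtain ⟨c', hc', hmin⟩ := (hV.image (fun y => |y|)).exists_pos_forall_le (by
      rintro _ ⟨y, ⟨hy, -⟩, rfl⟩
      exact abs_pos.mpr hy)
    refine ⟨min (c / 2) c', by positivity, fun s hs x hx hne i hi => ?_⟩
    obtain ⟨j, hj, hjmin⟩ := s.exists_min_image (fun i => |(x i : ℝ)|) ⟨i, hi⟩
    obtain ⟨m, hm, hmmax⟩ := s.exists_max_image (fun i => |(x i : ℝ)|) ⟨i, hi⟩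
    have hpos : ∀ i, 0 < |(x i : ℝ)| := fun i => abs_pos.mpr (x i).ne_zero
    refine (mul_le_mul_of_nonneg_left (hmmax i hi) (by positivity)).trans ?_
    by_cases h : j ≠ m ∧ |(x j : ℝ)| ≤ c / 2 * |(x m : ℝ)|
    · have h1 := ih (s.erase j) (by rw [Finset.card_erase_of_mem hj]; omega) x hx
        (fun I hI => hne I (hI.trans (Finset.erase_subset _ _))) m
        (Finset.mem_erase.mpr ⟨h.1.symm, hm⟩)
      have h2 : |∑ i ∈ s.erase j, (x i : ℝ)| ≤ |∑ i ∈ s, (x i : ℝ)| + |(x j : ℝ)| := by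
        rw [← Finset.sum_erase_add s _ hj]
        simpa using abs_sub (∑ i ∈ s.erase j, (x i : ℝ) + x j) (x j : ℝ)
      have h3 : min (c / 2) c' * |(x m : ℝ)| ≤ c / 2 * |(x m : ℝ)| :=
        mul_le_mul_of_nonneg_right (min_le_left _ _) (hpos m).le
      linarith [h.2]
    · have hsmall : |(x m : ℝ)| ≤ K * |(x j : ℝ)| := by
        by_cases hjm : j = m
        · rw [hjm]
          exact le_mul_of_one_le_left (hpos m).le (le_max_left _ _)
        · have h4 : c / 2 * |(x m : ℝ)| < |(x j : ℝ)| := by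
            by_contra! h'
            exact h ⟨hjm, h'⟩
          have h5 : |(x m : ℝ)| ≤ 2 / c * |(x j : ℝ)| := by
            rw [div_mul_eq_mul_div, le_div_iff₀ hc]
            linarith
          exact h5.trans (mul_le_mul_of_nonneg_right (le_max_right _ _) (hpos j).le)
      have hsum : ∑ i ∈ s, (x i : ℝ) = (x m : ℝ) * ∑ i ∈ s, ((if i ∈ s then x i / x m else 1 : ℝˣ) : ℝ) := by
        rw [Finset.mul_sum]
        refine Finset.sum_congr rfl fun i hi => ?_
        rw [if_pos hi, ← Units.val_mul, mul_div_cancel]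
      have h6 := hmin |∑ i ∈ s, ((if i ∈ s then x i / x m else 1 : ℝˣ) : ℝ)| (by
        refine ⟨_, ⟨?_, s, fun i => if i ∈ s then x i / x m else 1, ?_, rfl⟩, rfl⟩
        · intro h0
          rw [h0, mul_zero] at hsum
          exact hne s subset_rfl ⟨i, hi⟩ hsum
        · intro k _
          have hK1 : (1 : ℝ) ≤ K := le_max_left _ _
          by_cases hk : k ∈ s
          · simp only [if_pos hk]
            refine ⟨U.div_mem (hx k) (hx m), ?_, ?_⟩
            · rw [Units.val_div_eq_div_val, abs_div, div_le_iff₀ (hpos m)]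
              exact (hmmax k hk).trans (le_mul_of_one_le_left (hpos m).le hK1)
            · rw [inv_div, Units.val_div_eq_div_val, abs_div, div_le_iff₀ (hpos k)]
              exact hsmall.trans (mul_le_mul_of_nonneg_left (hjmin k hk) (by positivity))
          · simp only [if_neg hk]
            exact ⟨U.one_mem, by simpa using hK1, by simpa using hK1⟩)
      rw [hsum, abs_mul, mul_comm]
      refine mul_le_mul_of_nonneg_left ((min_le_right _ _).trans h6) (hpos m).le

/-- The terms of a minimal vanishing sum of units have comparable absolute values. -/
theorem exists_abs_le_mul_abs_of_minimal {U : Subgroup ℝˣ} (hU : ∀ K, (annulus U K).Finite)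
    (ι : Type*) [Finite ι] :
    ∃ K : ℝ, ∀ s : Finset ι, ∀ x : ι → ℝˣ, (∀ i, x i ∈ U) →
      ∑ i ∈ s, (x i : ℝ) = 0 → (∀ I ⊂ s, I.Nonempty → ∑ i ∈ I, (x i : ℝ) ≠ 0) →
      ∀ i ∈ s, ∀ j ∈ s, |(x i : ℝ)| ≤ K * |(x j : ℝ)| := by
  classical
  have := Fintype.ofFinite ι
  obtain ⟨c, hc, h⟩ := exists_mul_abs_le_abs_sum hU ι (Fintype.card ι)
  refine ⟨max 1 (1 / c), fun s x hx h0 hne i hi j hj => ?_⟩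
  have hpos : 0 < |(x j : ℝ)| := abs_pos.mpr (x j).ne_zero
  by_cases hij : i = j
  · rw [hij]
    exact le_mul_of_one_le_left hpos.le (le_max_left _ _)
  · have h1 := h (s.erase j) (Finset.card_le_univ _) x hx
      (fun I hI => hne I (hI.trans_ssubset (Finset.erase_ssubset hj))) i
      (Finset.mem_erase.mpr ⟨hij, hi⟩)
    rw [← Finset.sum_erase_add s _ hj] at h0
    rw [eq_neg_of_add_eq_zero_left h0, abs_neg] at h1
    refine le_trans ?_ (mul_le_mul_of_nonneg_right (le_max_right _ _) hpos.le)
    rw [div_mul_eq_mul_div, le_div_iff₀ hc]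
    linarith

/-- A vanishing sum decomposes into minimal vanishing subsums; `g i` is the block of `i`. -/
theorem exists_minimal_vanishing_blocks {ι M : Type*} [AddCommGroup M] (x : ι → M)
    (s : Finset ι) (hs : ∑ i ∈ s, x i = 0) :
    ∃ g : ι → Finset ι, ∀ i ∈ s, i ∈ g i ∧ g i ⊆ s ∧ (∀ j ∈ g i, g j = g i) ∧
      ∑ j ∈ g i, x j = 0 ∧ ∀ I ⊂ g i, I.Nonempty → ∑ j ∈ I, x j ≠ 0 := by
  classical
  induction s using Finset.strongInduction with
  | H s ih =>
    rcases s.eq_empty_or_nonempty with rfl | hne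
    · exact ⟨fun _ => ∅, by simp⟩
    · obtain ⟨T, -, hT⟩ := exists_minimal_le_of_wellFoundedLT
        (fun T : Finset ι => T ⊆ s ∧ T.Nonempty ∧ ∑ i ∈ T, x i = 0) s ⟨subset_rfl, hne, hs⟩
      obtain ⟨hTs, hTne, hT0⟩ := hT.prop
      obtain ⟨g, hg⟩ := ih (s \ T) (Finset.sdiff_ssubset hTs hTne) (by
        have := Finset.sum_sdiff (f := x) hTs
        rwa [hT0, add_zero, hs] at this)
      refine ⟨fun i => if i ∈ T then T else g i, fun i hi => ?_⟩
      by_cases hiT : i ∈ T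
      · simp only [if_pos hiT]
        refine ⟨hiT, hTs, fun j hj => if_pos hj, hT0, fun I hI hIne hI0 => ?_⟩
        exact hI.2 (hT.le_of_le ⟨hI.1.trans hTs, hIne, hI0⟩ hI.1)
      · simp only [if_neg hiT]
        obtain ⟨h1, h2, h3, h4⟩ := hg i (Finset.mem_sdiff.mpr ⟨hi, hiT⟩)
        refine ⟨h1, h2.trans Finset.sdiff_subset, fun j hj => ?_, h4⟩
        rw [if_neg (Finset.mem_sdiff.mp (h2 hj)).2, h3 j hj]

/-- Distinct values of `A` are never within a factor `K` of each other. -/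
def IsSeparated {ι : Type*} (K : ℝ) (A : ι → ℝ) : Prop :=
  ∀ p q, A p ≤ K * A q → A q ≤ K * A p → p = q

/-- If the terms of `u` are multiplicatively well separated and `u`, `w` have the same sum, then
every term of `u` is the sum of the terms of `w` in a group of comparable size. -/
theorem exists_grouping {U : Subgroup ℝˣ} (hU : ∀ K, (annulus U K).Finite) (hneg : -1 ∈ U)
    (α β : Type*) [Fintype α] [Fintype β] [DecidableEq α] :
    ∃ K₀ : ℝ, ∀ K ≥ K₀, ∀ (u : α → ℝˣ) (w : β → ℝˣ), (∀ a, u a ∈ U) → (∀ b, w b ∈ U) →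
      NoVanishingSubsum (fun b => (w b : ℝ)) →
      IsSeparated K (fun a => |(u a : ℝ)|) →
      ∑ a, (u a : ℝ) = ∑ b, (w b : ℝ) →
      ∃ f : β → α, (∀ a, ∑ b with f b = a, (w b : ℝ) = u a) ∧
        ∀ b, |(u (f b) : ℝ)| ≤ K * |(w b : ℝ)| ∧ |(w b : ℝ)| ≤ K * |(u (f b) : ℝ)| := by
  classical
  obtain ⟨K₀, hK⟩ := exists_abs_le_mul_abs_of_minimal hU (α ⊕ β)
  refine ⟨K₀, fun K hKK u w hu hw hnv hsep hsum => ?_⟩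
  set x : α ⊕ β → ℝˣ := Sum.elim u (fun b => -w b) with hxdef
  have hx : ∀ i, x i ∈ U := by
    rintro (a | b)
    · exact hu a
    · simpa [hxdef] using U.mul_mem hneg (hw b)
  obtain ⟨g, hg⟩ := exists_minimal_vanishing_blocks (fun i => (x i : ℝ)) Finset.univ (by
    simp [hxdef, hsum])
  simp only [Finset.mem_univ, Finset.subset_univ, true_and, forall_const] at hg
  have hcomp : ∀ i, ∀ j ∈ g i, |(x i : ℝ)| ≤ K * |(x j : ℝ)| ∧ |(x j : ℝ)| ≤ K * |(x i : ℝ)| := by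
    intro i j hj
    obtain ⟨h1, h2, h3, h4⟩ := hg i
    exact ⟨(hK (g i) x hx h3 h4 i h1 j hj).trans (by gcongr),
      (hK (g i) x hx h3 h4 j hj i h1).trans (by gcongr)⟩
  have huniq : ∀ i a a', Sum.inl a ∈ g i → Sum.inl a' ∈ g i → a = a' := by
    intro i a a' ha ha'
    have h := hcomp (Sum.inl a) (Sum.inl a') (by rwa [(hg i).2.1 _ ha])
    exact hsep a a' h.1 h.2
  have hex : ∀ b, ∃ a, Sum.inl a ∈ g (Sum.inr b) := by
    intro b
    by_contra! h
    have heq : g (Sum.inr b) = (Finset.univ.filter (fun b' => Sum.inr b' ∈ g (Sum.inr b))).map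
        Function.Embedding.inr := by
      ext (a | b')
      · simp [h a]
      · simp
    refine hnv (Finset.univ.filter (fun b' => Sum.inr b' ∈ g (Sum.inr b)))
      ⟨b, by simpa using (hg (Sum.inr b)).1⟩ ?_
    have h0 := (hg (Sum.inr b)).2.2.1
    rw [heq, Finset.sum_map] at h0
    simpa [hxdef] using h0
  choose f hf using hex
  have hfiff : ∀ a b, f b = a ↔ Sum.inr b ∈ g (Sum.inl a) := by
    intro a b
    constructor
    · rintro rfl
      rw [(hg (Sum.inr b)).2.1 _ (hf b)]
      exact (hg _).1
    · intro h
      have h1 := hf b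
      rw [(hg (Sum.inl a)).2.1 _ h] at h1
      exact huniq _ _ _ h1 (hg (Sum.inl a)).1
  refine ⟨f, fun a => ?_, fun b => ?_⟩
  · have heq : g (Sum.inl a) = ({a} : Finset α).disjSum (Finset.univ.filter (fun b => f b = a)) := by
      ext (a' | b)
      · simp only [Finset.inl_mem_disjSum, Finset.mem_singleton]
        exact ⟨fun h => huniq _ _ _ h (hg _).1, fun h => h ▸ (hg _).1⟩
      · simp [hfiff]
    have h0 := (hg (Sum.inl a)).2.2.1
    rw [heq, Finset.sum_disjSum] at h0
    simp [hxdef] at h0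
    linarith
  · simpa [hxdef] using (hcomp _ _ (hf b)).symm

/-- The number of elements of `U` of absolute value between `1` and `X / c` is `O(log X)`. -/
theorem exists_ncard_le_mul_log {U : Subgroup ℝˣ} (hU : ∀ K, (annulus U K).Finite)
    {c : ℝ} (hc : 0 < c) :
    ∃ C : ℝ, 0 ≤ C ∧ ∀ X : ℝ, 2 ≤ X →
      {t : ℝˣ | t ∈ U ∧ 1 ≤ |(t : ℝ)| ∧ c * |(t : ℝ)| ≤ X}.Finite ∧
      ({t : ℝˣ | t ∈ U ∧ 1 ≤ |(t : ℝ)| ∧ c * |(t : ℝ)| ≤ X}.ncard : ℝ) ≤ C * Real.log X := by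
  set F := annulus U (Real.exp 1) with hF
  have hpos : ∀ t : ℝˣ, 0 < |(t : ℝ)| := fun t => abs_pos.mpr t.ne_zero
  have hrep : ∀ n : ℕ, ∃ g : ℝˣ, ∀ t ∈ U, (n : ℝ) ≤ Real.log |(t : ℝ)| →
      Real.log |(t : ℝ)| < n + 1 → t / g ∈ F := by
    intro n
    by_cases h : ∃ g ∈ U, (n : ℝ) ≤ Real.log |(g : ℝ)| ∧ Real.log |(g : ℝ)| < n + 1
    · obtain ⟨g, hg, h1, h2⟩ := h
      have key : ∀ a b : ℝˣ, Real.log |(a : ℝ)| ≤ Real.log |(b : ℝ)| + 1 →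
          |((a / b : ℝˣ) : ℝ)| ≤ Real.exp 1 := by
        intro a b hab
        rw [← Real.log_le_iff_le_exp (hpos _), Units.val_div_eq_div_val, abs_div,
          Real.log_div (hpos a).ne' (hpos b).ne']
        linarith
      refine ⟨g, fun t ht h3 h4 => ⟨U.div_mem ht hg, key t g (by linarith), ?_⟩⟩
      rw [inv_div]
      exact key g t (by linarith)
    · push Not at h
      exact ⟨1, fun t ht h3 h4 => absurd (h t ht h3) (not_le.mpr h4)⟩
  choose g hg using hrep
  refine ⟨(1 + (|Real.log c| + 1) / Real.log 2) * F.ncard, ?_, fun X hX => ?_⟩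
  · have := Real.log_pos one_lt_two
    positivity
  set m := ⌊Real.log (X / c)⌋₊ with hm
  have hfin : ((Finset.range (m + 1) : Set ℕ) ×ˢ F).Finite :=
    (Finset.finite_toSet _).prod (hU _)
  have hsub : {t : ℝˣ | t ∈ U ∧ 1 ≤ |(t : ℝ)| ∧ c * |(t : ℝ)| ≤ X} ⊆
      (fun p : ℕ × ℝˣ => g p.1 * p.2) '' ((Finset.range (m + 1) : Set ℕ) ×ˢ F) := by
    rintro t ⟨ht, h1, h2⟩
    have hlog : 0 ≤ Real.log |(t : ℝ)| := Real.log_nonneg h1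
    have hle : Real.log |(t : ℝ)| ≤ Real.log (X / c) :=
      Real.log_le_log (hpos t) (by rw [le_div_iff₀ hc]; linarith)
    refine ⟨(⌊Real.log |(t : ℝ)|⌋₊, t / g ⌊Real.log |(t : ℝ)|⌋₊), ⟨?_, ?_⟩, by simp⟩
    · simpa [Nat.lt_succ_iff] using Nat.floor_le_floor hle
    · exact hg _ t ht (Nat.floor_le hlog) (Nat.lt_floor_add_one _)
  refine ⟨(hfin.image _).subset hsub, ?_⟩
  have hcard : {t : ℝˣ | t ∈ U ∧ 1 ≤ |(t : ℝ)| ∧ c * |(t : ℝ)| ≤ X}.ncard ≤ (m + 1) * F.ncard := by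
    refine (Set.ncard_le_ncard hsub (hfin.image _)).trans ((Set.ncard_image_le hfin).trans ?_)
    rw [Set.ncard_prod, Set.ncard_coe_finset, Finset.card_range]
  have hl2 : 0 < Real.log 2 := Real.log_pos one_lt_two
  have hlX : Real.log 2 ≤ Real.log X := Real.log_le_log two_pos hX
  have hm1 : (m : ℝ) + 1 ≤ (1 + (|Real.log c| + 1) / Real.log 2) * Real.log X := by
    have h1 : (m : ℝ) ≤ Real.log X + |Real.log c| := by
      by_cases h0 : 0 ≤ Real.log (X / c)
      · refine (Nat.floor_le h0).trans ?_
        rw [Real.log_div (by linarith) hc.ne']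
        linarith [neg_abs_le (Real.log c)]
      · rw [hm, Nat.floor_of_nonpos (not_le.mp h0).le]
        have := abs_nonneg (Real.log c)
        push_cast
        linarith
    have h2 : |Real.log c| + 1 ≤ (|Real.log c| + 1) / Real.log 2 * Real.log X := by
      rw [div_mul_eq_mul_div, le_div_iff₀ hl2]
      exact mul_le_mul_of_nonneg_left hlX (by positivity)
    linarith
  calc _ ≤ (((m + 1) * F.ncard : ℕ) : ℝ) := by exact_mod_cast hcard
    _ = ((m : ℝ) + 1) * F.ncard := by push_cast; ring
    _ ≤ ((1 + (|Real.log c| + 1) / Real.log 2) * Real.log X) * F.ncard :=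
        mul_le_mul_of_nonneg_right hm1 (by positivity)
    _ = _ := by ring

/-- The tuples of units of absolute value between `1` and `X / c` in which some term has absolute
value at most `K`, or some two terms have absolute values within a factor `K` of each other. -/
def clusteredTuples (U : Subgroup ℝˣ) (K c : ℝ) (ρ : ℕ) (X : ℝ) : Set (Fin ρ → ℝˣ) :=
  {v | (∀ i, v i ∈ U ∧ 1 ≤ |(v i : ℝ)| ∧ c * |(v i : ℝ)| ≤ X) ∧
    ((∃ i, |(v i : ℝ)| ≤ K) ∨
      ∃ i j, i ≠ j ∧ |(v i : ℝ)| ≤ K * |(v j : ℝ)| ∧ |(v j : ℝ)| ≤ K * |(v i : ℝ)|)}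

theorem exists_ncard_clusteredTuples_le {U : Subgroup ℝˣ} (hU : ∀ K, (annulus U K).Finite)
    (K : ℝ) {c : ℝ} (hc : 0 < c) (r : ℕ) :
    ∃ C : ℝ, 0 ≤ C ∧ ∀ X : ℝ, 2 ≤ X → (clusteredTuples U K c (r + 1) X).Finite ∧
      ((clusteredTuples U K c (r + 1) X).ncard : ℝ) ≤ C * Real.log X ^ r := by
  obtain ⟨C, hC, h⟩ := exists_ncard_le_mul_log hU hc
  set F := annulus U (max 1 K) with hF
  refine ⟨((r + 1) * (r + 1) * F.ncard : ℕ) * C ^ r, by positivity, fun X hX => ?_⟩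
  obtain ⟨hBfin, hBcard⟩ := h X hX
  set B := {t : ℝˣ | t ∈ U ∧ 1 ≤ |(t : ℝ)| ∧ c * |(t : ℝ)| ≤ X} with hB
  have hpos : ∀ t : ℝˣ, 0 < |(t : ℝ)| := fun t => abs_pos.mpr t.ne_zero
  let D : Set (((Fin (r + 1) × Option (Fin r)) × ℝˣ) × (Fin r → ℝˣ)) :=
    (Set.univ ×ˢ F) ×ˢ Set.pi Set.univ (fun _ => B)
  let dec : ((Fin (r + 1) × Option (Fin r)) × ℝˣ) × (Fin r → ℝˣ) → (Fin (r + 1) → ℝˣ) :=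
    fun p => Fin.insertNth p.1.1.1 (p.1.2 * p.1.1.2.elim 1 p.2) p.2
  have hDfin : D.Finite := (Set.finite_univ.prod (hU _)).prod (Set.Finite.pi fun _ => hBfin)
  have hsub : clusteredTuples U K c (r + 1) X ⊆ dec '' D := by
    rintro v ⟨hv, hcl⟩
    have hmain : ∃ (i : Fin (r + 1)) (o : Option (Fin r)),
        v i / o.elim 1 (fun j => v (i.succAbove j)) ∈ F := by
      rcases hcl with ⟨i, hi⟩ | ⟨i, j, hij, h1, h2⟩
      · refine ⟨i, none, ?_⟩
        simp only [Option.elim_none, div_one]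
        refine ⟨(hv i).1, hi.trans (le_max_right _ _), ?_⟩
        rw [Units.val_inv_eq_inv_val, abs_inv]
        exact (inv_le_one_of_one_le₀ (hv i).2.1).trans (le_max_left _ _)
      · obtain ⟨j, rfl⟩ := Fin.exists_succAbove_eq hij.symm
        refine ⟨i, some j, ?_⟩
        simp only [Option.elim_some]
        refine ⟨U.div_mem (hv _).1 (hv _).1, ?_, ?_⟩
        · rw [Units.val_div_eq_div_val, abs_div, div_le_iff₀ (hpos _)]
          exact h1.trans (mul_le_mul_of_nonneg_right (le_max_right _ _) (hpos _).le)
        · rw [inv_div, Units.val_div_eq_div_val, abs_div, div_le_iff₀ (hpos _)]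
          exact h2.trans (mul_le_mul_of_nonneg_right (le_max_right _ _) (hpos _).le)
    obtain ⟨i, o, hio⟩ := hmain
    refine ⟨(((i, o), _), fun j => v (i.succAbove j)), ⟨⟨Set.mem_univ _, hio⟩,
      fun j _ => hv _⟩, ?_⟩
    simp only [dec, div_mul_cancel]
    exact Fin.insertNth_self_removeNth i v
  refine ⟨(hDfin.image _).subset hsub, ?_⟩
  have hpi : (Set.pi Set.univ (fun _ : Fin r => B)).ncard = B.ncard ^ r := by
    rw [← Nat.card_coe_set_eq, Nat.card_congr (Equiv.Set.univPi _), Nat.card_pi]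
    simp
  have hcard : (clusteredTuples U K c (r + 1) X).ncard ≤ (r + 1) * (r + 1) * F.ncard * B.ncard ^ r := by
    refine (Set.ncard_le_ncard hsub (hDfin.image _)).trans ((Set.ncard_image_le hDfin).trans ?_)
    rw [Set.ncard_prod, Set.ncard_prod, hpi, Set.ncard_univ]
    simp
  calc _ ≤ (((r + 1) * (r + 1) * F.ncard * B.ncard ^ r : ℕ) : ℝ) := by exact_mod_cast hcard
    _ = ((r + 1) * (r + 1) * F.ncard : ℕ) * (B.ncard : ℝ) ^ r := by push_cast; ring
    _ ≤ ((r + 1) * (r + 1) * F.ncard : ℕ) * (C * Real.log X) ^ r := by gcongr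
    _ = _ := by rw [mul_pow]; ring

theorem exists_eq_add_mul_sqrt {d : ℕ} {x : ℝ} (hx : x ∈ ℚ⟮(Real.sqrt d)⟯) :
    ∃ a b : ℚ, x = a + b * Real.sqrt d := by
  have hint : IsIntegral ℚ (Real.sqrt d) := by
    refine ⟨Polynomial.X ^ 2 - Polynomial.C (d : ℚ), Polynomial.monic_X_pow_sub_C _ two_ne_zero, ?_⟩
    simp
  rw [← IntermediateField.mem_toSubalgebra,
    IntermediateField.adjoin_simple_toSubalgebra_of_isAlgebraic hint.isAlgebraic] at hx
  induction hx using Algebra.adjoin_induction with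
  | mem x hx => exact ⟨0, 1, by simpa using hx⟩
  | algebraMap r => exact ⟨r, 0, by simp⟩
  | add x y _ _ hx hy =>
    obtain ⟨a, b, rfl⟩ := hx
    obtain ⟨a', b', rfl⟩ := hy
    exact ⟨a + a', b + b', by push_cast; ring⟩
  | mul x y _ _ hx hy =>
    obtain ⟨a, b, rfl⟩ := hx
    obtain ⟨a', b', rfl⟩ := hy
    refine ⟨a * a' + b * b' * d, a * b' + a' * b, ?_⟩
    have h : Real.sqrt d * Real.sqrt d = d := Real.mul_self_sqrt (Nat.cast_nonneg d)
    push_cast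
    linear_combination (b * b' : ℝ) * h

/-- An element of a real quadratic field has rational trace and norm. -/
theorem exists_rat_trace_norm {d : ℕ} {L : IntermediateField ℚ ℝ} (hL : L = ℚ⟮(Real.sqrt d)⟯)
    {σ : L ≃ₐ[ℚ] L} (hσ : σ ≠ AlgEquiv.refl) (x : L) :
    (∃ q : ℚ, x + σ x = q) ∧ ∃ q : ℚ, x * σ x = q := by
  subst hL
  set s : ℚ⟮(Real.sqrt d)⟯ := ⟨Real.sqrt d, mem_adjoin_simple_self ℚ _⟩ with hs
  have hs2 : s * s = d := Subtype.ext (by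
    simp [hs])
  have hrep : ∀ y : ℚ⟮(Real.sqrt d)⟯, ∃ a b : ℚ, y = a + b * s := by
    intro y
    obtain ⟨a, b, h⟩ := exists_eq_add_mul_sqrt y.2
    exact ⟨a, b, Subtype.ext (by simpa [hs] using h)⟩
  have hσs : σ s = -s := by
    have h : σ s * σ s = s * s := by rw [← map_mul, hs2, map_natCast]
    rcases mul_self_eq_mul_self_iff.mp h with h | h
    · refine absurd (AlgEquiv.ext fun y => ?_) hσ
      obtain ⟨a, b, rfl⟩ := hrep y
      simp [h]
    · exact h
  obtain ⟨a, b, rfl⟩ := hrep x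
  refine ⟨⟨2 * a, ?_⟩, ⟨a ^ 2 - d * b ^ 2, ?_⟩⟩
  · simp only [map_add, map_mul, map_ratCast, hσs]
    push_cast
    ring
  · simp only [map_add, map_mul, map_ratCast, hσs]
    push_cast
    linear_combination (-(b : ℚ⟮(Real.sqrt d)⟯) ^ 2) * hs2

theorem exists_int_eq_of_isIntegral {L : Type*} [Field L] [CharZero L] {x : L}
    (hx : IsIntegral ℤ x) {q : ℚ} (hq : x = q) : ∃ n : ℤ, x = n := by
  have h : IsIntegral ℤ (algebraMap ℚ L q) := by simpa [hq] using hx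
  rw [isIntegral_algebraMap_iff (algebraMap ℚ L).injective] at h
  obtain ⟨n, hn⟩ := IsIntegrallyClosed.isIntegral_iff.mp h
  exact ⟨n, by rw [hq, ← hn]; simp⟩

/-- The embedding of the unit group of `𝓞 L` into the real numbers. -/
noncomputable def realUnit (L : IntermediateField ℚ ℝ) : (𝓞 L)ˣ →* ℝˣ :=
  Units.map ((algebraMap L ℝ).comp (algebraMap (𝓞 L) L)).toMonoidHom

theorem coe_realUnit (L : IntermediateField ℚ ℝ) (v : (𝓞 L)ˣ) :
    (realUnit L v : ℝ) = (((v : 𝓞 L) : L) : ℝ) := rfl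

theorem realUnit_injective (L : IntermediateField ℚ ℝ) : Function.Injective (realUnit L) := by
  intro v w h
  have h1 := congrArg (fun t : ℝˣ => (t : ℝ)) h
  simp only [coe_realUnit] at h1
  exact Units.ext (RingOfIntegers.ext (Subtype.ext h1))

theorem exists_int_trace {d : ℕ} {L : IntermediateField ℚ ℝ} (hL : L = ℚ⟮(Real.sqrt d)⟯)
    {σ : L ≃ₐ[ℚ] L} (hσ : σ ≠ AlgEquiv.refl) (v : 𝓞 L) :
    ∃ n : ℤ, (v : L) + σ (v : L) = n := by
  obtain ⟨q, hq⟩ := (exists_rat_trace_norm hL hσ (v : L)).1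
  exact exists_int_eq_of_isIntegral
    (v.isIntegral_coe.add (v.isIntegral_coe.map (σ.restrictScalars ℤ))) hq

theorem exists_int_norm {d : ℕ} {L : IntermediateField ℚ ℝ} (hL : L = ℚ⟮(Real.sqrt d)⟯)
    {σ : L ≃ₐ[ℚ] L} (hσ : σ ≠ AlgEquiv.refl) (v : 𝓞 L) :
    ∃ n : ℤ, (v : L) * σ (v : L) = n := by
  obtain ⟨q, hq⟩ := (exists_rat_trace_norm hL hσ (v : L)).2
  exact exists_int_eq_of_isIntegral
    (v.isIntegral_coe.mul (v.isIntegral_coe.map (σ.restrictScalars ℤ))) hq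

/-- The conjugate of a unit is its inverse up to sign. -/
theorem conj_unit {d : ℕ} {L : IntermediateField ℚ ℝ} (hL : L = ℚ⟮(Real.sqrt d)⟯)
    {σ : L ≃ₐ[ℚ] L} (hσ : σ ≠ AlgEquiv.refl) (v : (𝓞 L)ˣ) :
    σ ((v : 𝓞 L) : L) = ((v⁻¹ : (𝓞 L)ˣ) : 𝓞 L) ∨
      σ ((v : 𝓞 L) : L) = ((-v⁻¹ : (𝓞 L)ˣ) : 𝓞 L) := by
  obtain ⟨n, hn⟩ := exists_int_norm hL hσ v
  obtain ⟨m, hm⟩ := exists_int_norm hL hσ ((v⁻¹ : (𝓞 L)ˣ) : 𝓞 L)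
  have hvv : ((v : 𝓞 L) : L) * (((v⁻¹ : (𝓞 L)ˣ) : 𝓞 L) : L) = 1 := by
    rw [← map_mul, Units.mul_inv, map_one]
  have hvv' : σ ((v : 𝓞 L) : L) * σ (((v⁻¹ : (𝓞 L)ˣ) : 𝓞 L) : L) = 1 := by
    rw [← map_mul, hvv, map_one]
  have hnm : n * m = 1 := by
    have h : ((n * m : ℤ) : L) = 1 := by
      push_cast
      rw [← hn, ← hm]
      linear_combination hvv * (σ ((v : 𝓞 L) : L) * σ (((v⁻¹ : (𝓞 L)ˣ) : 𝓞 L) : L)) + hvv'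
    exact_mod_cast h
  rcases Int.isUnit_iff.mp (IsUnit.of_mul_eq_one m hnm) with rfl | rfl
  · left
    push_cast at hn
    linear_combination (((v⁻¹ : (𝓞 L)ˣ) : 𝓞 L) : L) * hn - σ ((v : 𝓞 L) : L) * hvv
  · right
    push_cast at hn
    simp only [Units.val_neg, map_neg]
    linear_combination (((v⁻¹ : (𝓞 L)ˣ) : 𝓞 L) : L) * hn - σ ((v : 𝓞 L) : L) * hvv

theorem finite_annulus_range_realUnit {d : ℕ} {L : IntermediateField ℚ ℝ}
    (hL : L = ℚ⟮(Real.sqrt d)⟯) {σ : L ≃ₐ[ℚ] L} (hσ : σ ≠ AlgEquiv.refl) (K : ℝ) :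
    (annulus (realUnit L).range K).Finite := by
  have hfin : (⋃ p ∈ (Set.Icc (-⌈2 * K⌉) ⌈2 * K⌉ ×ˢ {1, -1} : Set (ℤ × ℤ)),
      {t : ℝ | t ^ 2 + p.1 * t + p.2 = 0}).Finite := by
    refine Set.Finite.biUnion ((Set.finite_Icc _ _).prod (Set.toFinite _)) fun p _ => ?_
    set P : Polynomial ℝ := Polynomial.X ^ 2 + Polynomial.C (p.1 : ℝ) * Polynomial.X +
      Polynomial.C (p.2 : ℝ) with hP
    have hP0 : P ≠ 0 := by
      intro h
      have := congrArg (fun Q => Polynomial.coeff Q 2) h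
      simp only [hP, Polynomial.coeff_add, Polynomial.coeff_X_pow, Polynomial.coeff_C_mul,
        Polynomial.coeff_X, Polynomial.coeff_C, Polynomial.coeff_zero] at this
      norm_num at this
    refine (Polynomial.finite_setOfPred_isRoot hP0).subset fun t ht => ?_
    simpa [hP, Polynomial.IsRoot] using ht
  refine Set.Finite.of_finite_image (f := Units.val) (hfin.subset ?_) Units.val_injective.injOn
  rintro _ ⟨_, ⟨⟨v, rfl⟩, h1, h2⟩, rfl⟩
  obtain ⟨n, hn⟩ := exists_int_trace hL hσ v
  have hinv : (realUnit L v : ℝ) * ((realUnit L v)⁻¹ : ℝˣ) = 1 := Units.mul_inv _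
  have hcoe : ((((v⁻¹ : (𝓞 L)ˣ) : 𝓞 L) : L) : ℝ) = ((realUnit L v)⁻¹ : ℝˣ) := by
    rw [← map_inv, coe_realUnit]
  obtain ⟨e, he, hσv⟩ : ∃ e ∈ ({1, -1} : Set ℤ),
      ((σ ((v : 𝓞 L) : L) : L) : ℝ) = e * ((realUnit L v)⁻¹ : ℝˣ) := by
    rcases conj_unit hL hσ v with h | h
    · exact ⟨1, by simp, by rw [h, hcoe]; simp⟩
    · exact ⟨-1, by simp, by rw [h, ← coe_realUnit, ← hcoe, coe_realUnit]; simp⟩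
  have hn' : (realUnit L v : ℝ) + e * ((realUnit L v)⁻¹ : ℝˣ) = n := by
    rw [← hσv, coe_realUnit]
    exact_mod_cast congrArg (fun y : L => (y : ℝ)) hn
  have he1 : |(e : ℝ)| = 1 := by
    rcases he with rfl | rfl <;> simp
  have hnK : |(n : ℝ)| ≤ 2 * K := by
    rw [← hn']
    refine (abs_add_le _ _).trans ?_
    rw [abs_mul, he1, one_mul]
    linarith
  have hnK' : |n| ≤ ⌈2 * K⌉ := by
    exact_mod_cast (hnK.trans (Int.le_ceil _))
  simp only [Set.mem_iUnion]
  refine ⟨(-n, e), ⟨⟨by linarith [(abs_le.mp hnK').2], by linarith [(abs_le.mp hnK').1]⟩, he⟩, ?_⟩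
  simp only [Set.mem_ofPred_eq]
  push_cast
  linear_combination (realUnit L v : ℝ) * hn' - (e : ℝ) * hinv

theorem exists_ncard_clusteredTuples_le_rpow {U : Subgroup ℝˣ} (hU : ∀ K, (annulus U K).Finite)
    (K : ℝ) {c : ℝ} (hc : 0 < c) (ρ : ℕ) :
    ∃ C : ℝ, 0 ≤ C ∧ ∀ X : ℝ, 2 ≤ X → (clusteredTuples U K c ρ X).Finite ∧
      ((clusteredTuples U K c ρ X).ncard : ℝ) ≤ C * Real.log X ^ ((ρ : ℝ) - 1) := by
  cases ρ with
  | zero =>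
    have h : ∀ X, clusteredTuples U K c 0 X = ∅ := fun X => by
      ext v
      simp [clusteredTuples]
    exact ⟨0, le_rfl, fun X _ => by simp [h]⟩
  | succ r =>
    obtain ⟨C, hC, h⟩ := exists_ncard_clusteredTuples_le hU K hc r
    refine ⟨C, hC, fun X hX => ⟨(h X hX).1, ?_⟩⟩
    rw [Nat.cast_succ, add_sub_cancel_right, Real.rpow_natCast]
    exact (h X hX).2

theorem isSeparated_append_inv {n : ℕ} {K : ℝ} (hK : 1 ≤ K) {a : Fin n → ℝ}
    (haK : ∀ i, K < a i) (ha : IsSeparated K a) :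
    IsSeparated K (Fin.append a (fun i => (a i)⁻¹)) := by
  have hpos : ∀ i, 0 < a i := fun i => by linarith [haK i]
  have key : ∀ i j, ¬ a i ≤ K * (a j)⁻¹ := by
    intro i j h
    have h1 : K * (a j)⁻¹ ≤ K :=
      mul_le_of_le_one_right (by linarith) (inv_le_one_of_one_le₀ (by linarith [haK j]))
    linarith [haK i]
  intro p q
  refine Fin.addCases (fun i => ?_) (fun i => ?_) p <;>
    refine Fin.addCases (fun j => ?_) (fun j => ?_) q <;>
    simp only [Fin.append_left, Fin.append_right] <;> intro h1 h2
  · rw [ha i j h1 h2]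
  · exact absurd h1 (key i j)
  · exact absurd h2 (key j i)
  · have inv_le : ∀ i j, (a i)⁻¹ ≤ K * (a j)⁻¹ → a j ≤ K * a i := by
      intro i j h
      rwa [← div_eq_mul_inv, le_div_iff₀ (hpos j), inv_mul_eq_div, div_le_iff₀ (hpos i)] at h
    rw [ha i j (inv_le j i h2) (inv_le i j h1)]

theorem append_inv_away_from_one {n : ℕ} {K : ℝ} (hK : 1 ≤ K) {a : Fin n → ℝ}
    (haK : ∀ i, K < a i) (p : Fin (n + n))
    (h1 : Fin.append a (fun i => (a i)⁻¹) p ≤ K) :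
    ¬ 1 ≤ K * Fin.append a (fun i => (a i)⁻¹) p := by
  intro h2
  revert h1 h2
  refine Fin.addCases (fun i => ?_) (fun i => ?_) p <;>
    simp only [Fin.append_left, Fin.append_right] <;> intro h1 h2
  · linarith [haK i]
  · rw [← div_eq_mul_inv, le_div_iff₀ (by linarith [haK i])] at h2
    linarith [haK i]

theorem IsSeparated.append_one {n : ℕ} {K : ℝ} {A : Fin n → ℝ} (hA : IsSeparated K A)
    (hA1 : ∀ p, A p ≤ K → ¬ 1 ≤ K * A p) :
    IsSeparated K (Fin.append A (fun _ : Fin 1 => 1)) := by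
  intro p q
  refine Fin.addCases (fun i => ?_) (fun i => ?_) p <;>
    refine Fin.addCases (fun j => ?_) (fun j => ?_) q <;>
    simp only [Fin.append_left, Fin.append_right, mul_one] <;> intro h1 h2
  · rw [hA i j h1 h2]
  · exact absurd h2 (hA1 i h1)
  · exact absurd h1 (hA1 j h2)
  · rw [Subsingleton.elim i j]

/-- The tuple of shape `(S₁)`, `(S₂)` or `(S₃)` built from `v`. -/
noncomputable def shape (L : IntermediateField ℚ ℝ) (σ : L ≃ₐ[ℚ] L) (ρ : ℕ) (s : Fin 3)
    (v : Fin ρ → (𝓞 L)ˣ) : (m : ℕ) × (Fin m → L) :=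
  ![shapeS1 L σ ρ v, shapeS2 L σ ρ v, shapeS3 L σ ρ v] s

section Shapes

variable {d : ℕ} {L : IntermediateField ℚ ℝ} {σ : L ≃ₐ[ℚ] L} {ρ : ℕ}

theorem exists_shape_of_mem_TSet {k : ℕ} {X : ℝ} {u : (m : ℕ) × (Fin m → L)}
    (hu : u ∈ TSet L σ k X) :
    ∃ (s : Fin 3) (v : Fin (k / 2) → (𝓞 L)ˣ),
      (∀ i, 1 ≤ |(((v i : 𝓞 L) : L) : ℝ)|) ∧ u = shape L σ (k / 2) s v := by
  obtain ⟨⟨v, hv, h | ⟨-, h | h⟩⟩, -⟩ := hu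
  exacts [⟨0, v, hv, h⟩, ⟨1, v, hv, h⟩, ⟨2, v, hv, h⟩]

theorem shape_length_le (s : Fin 3) (v : Fin ρ → (𝓞 L)ˣ) :
    (shape L σ ρ s v).1 ≤ ρ + ρ + 1 := by
  fin_cases s
  exacts [Nat.le_succ _, le_rfl, le_rfl]

theorem exists_unit_eq_append {a b : ℕ} {x : Fin a → L} {y : Fin b → L}
    (hx : ∀ i, ∃ e : (𝓞 L)ˣ, x i = (e : 𝓞 L)) (hy : ∀ i, ∃ e : (𝓞 L)ˣ, y i = (e : 𝓞 L))
    (p : Fin (a + b)) : ∃ e : (𝓞 L)ˣ, Fin.append x y p = (e : 𝓞 L) := by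
  refine Fin.addCases (fun i => ?_) (fun i => ?_) p
  · simpa only [Fin.append_left] using hx i
  · simpa only [Fin.append_right] using hy i

theorem exists_unit_eq_shape (hL : L = ℚ⟮(Real.sqrt d)⟯) (hσ : σ ≠ AlgEquiv.refl) (s : Fin 3)
    (v : Fin ρ → (𝓞 L)ˣ) (p : Fin (shape L σ ρ s v).1) :
    ∃ e : (𝓞 L)ˣ, (shape L σ ρ s v).2 p = (e : 𝓞 L) := by
  have hconj : ∀ i, ∃ e : (𝓞 L)ˣ, σ ((v i : 𝓞 L) : L) = (e : 𝓞 L) := fun i =>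
    (conj_unit hL hσ (v i)).elim (fun h => ⟨_, h⟩) (fun h => ⟨_, h⟩)
  have hbase := exists_unit_eq_append (fun i => ⟨v i, rfl⟩) hconj
  have hone := exists_unit_eq_append hbase (y := fun _ : Fin 1 => (1 : L))
    (fun _ => ⟨1, by simp⟩)
  have hneg := exists_unit_eq_append hbase (y := fun _ : Fin 1 => (-1 : L))
    (fun _ => ⟨-1, by simp⟩)
  fin_cases s
  exacts [hbase p, hone p, hneg p]

theorem abs_append_conj (hL : L = ℚ⟮(Real.sqrt d)⟯) (hσ : σ ≠ AlgEquiv.refl)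
    (v : Fin ρ → (𝓞 L)ˣ) (p : Fin (ρ + ρ)) :
    |((Fin.append (fun i => ((v i : 𝓞 L) : L)) (fun i => σ ((v i : 𝓞 L) : L)) p : L) : ℝ)| =
      Fin.append (fun i => |(realUnit L (v i) : ℝ)|) (fun i => |(realUnit L (v i) : ℝ)|⁻¹) p := by
  refine Fin.addCases (fun i => ?_) (fun i => ?_) p
  · simp only [Fin.append_left, coe_realUnit]
  · simp only [Fin.append_right]
    rw [← abs_inv, ← Units.val_inv_eq_inv_val, ← map_inv]
    rcases conj_unit hL hσ (v i) with h | h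
    · rw [h, coe_realUnit]
    · rw [h, coe_realUnit, Units.val_neg]
      simp

theorem abs_shape_zero (hL : L = ℚ⟮(Real.sqrt d)⟯) (hσ : σ ≠ AlgEquiv.refl)
    (v : Fin ρ → (𝓞 L)ˣ) :
    (fun p => |((shape L σ ρ 0 v).2 p : ℝ)|) =
      Fin.append (fun i => |(realUnit L (v i) : ℝ)|) (fun i => |(realUnit L (v i) : ℝ)|⁻¹) :=
  funext (abs_append_conj hL hσ v)

theorem abs_shape_ne_zero (hL : L = ℚ⟮(Real.sqrt d)⟯) (hσ : σ ≠ AlgEquiv.refl)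
    {s : Fin 3} (hs : s ≠ 0) (v : Fin ρ → (𝓞 L)ˣ) :
    ∃ h : (shape L σ ρ s v).1 = ρ + ρ + 1,
      (fun p => |((shape L σ ρ s v).2 (Fin.cast h.symm p) : ℝ)|) = Fin.append
        (Fin.append (fun i => |(realUnit L (v i) : ℝ)|) (fun i => |(realUnit L (v i) : ℝ)|⁻¹))
        (fun _ : Fin 1 => 1) := by
  fin_cases s
  · exact absurd rfl hs
  all_goals
    refine ⟨rfl, funext fun p => ?_⟩
    change |((Fin.append _ _ p : L) : ℝ)| = _
    refine Fin.addCases (fun i => ?_) (fun i => ?_) p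
    · simp only [Fin.append_left]
      exact abs_append_conj hL hσ v i
    · simp

theorem isSeparated_shape (hL : L = ℚ⟮(Real.sqrt d)⟯) (hσ : σ ≠ AlgEquiv.refl) {K : ℝ}
    (hK : 1 ≤ K) (s : Fin 3) {v : Fin ρ → (𝓞 L)ˣ} (hvK : ∀ i, K < |(realUnit L (v i) : ℝ)|)
    (hv : IsSeparated K (fun i => |(realUnit L (v i) : ℝ)|)) :
    IsSeparated K (fun p => |((shape L σ ρ s v).2 p : ℝ)|) := by
  have h0 := isSeparated_append_inv hK hvK hv
  by_cases hs : s = 0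
  · subst hs
    rw [abs_shape_zero hL hσ]
    exact h0
  · obtain ⟨h, habs⟩ := abs_shape_ne_zero hL hσ hs v
    have h1 := h0.append_one (append_inv_away_from_one hK hvK)
    rw [← habs] at h1
    exact fun p q hp hq => by simpa using h1 (Fin.cast h p) (Fin.cast h q) hp hq

theorem exists_shape_eq (s : Fin 3) (v : Fin ρ → (𝓞 L)ˣ) (i : Fin ρ) :
    ∃ p, (shape L σ ρ s v).2 p = (v i : 𝓞 L) := by
  have h := Fin.append_left (fun i => ((v i : 𝓞 L) : L)) (fun i => σ ((v i : 𝓞 L) : L)) i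
  have h' := fun y : Fin 1 → L => (Fin.append_left _ y (Fin.castAdd ρ i)).trans h
  fin_cases s
  exacts [⟨_, h⟩, ⟨_, h' fun _ => 1⟩, ⟨_, h' fun _ => -1⟩]

/-- The coordinates of a shaped tuple as real units. -/
theorem exists_realUnit_lift (hL : L = ℚ⟮(Real.sqrt d)⟯) (hσ : σ ≠ AlgEquiv.refl) (s : Fin 3)
    (v : Fin ρ → (𝓞 L)ˣ) :
    ∃ x : Fin (shape L σ ρ s v).1 → ℝˣ, (∀ p, x p ∈ (realUnit L).range) ∧
      ∀ p, (x p : ℝ) = (shape L σ ρ s v).2 p := by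
  choose e he using exists_unit_eq_shape hL hσ s v
  exact ⟨fun p => realUnit L (e p), fun p => ⟨e p, rfl⟩, fun p => by rw [coe_realUnit, he]⟩

theorem NoVanishingSubsum.real {ι : Type*} {y : ι → L} (hy : NoVanishingSubsum y) :
    NoVanishingSubsum (fun i => (y i : ℝ)) := by
  intro I hI h
  refine hy I hI (Subtype.ext ?_)
  simpa using h

/-- A shaped tuple whose units are well separated represents its sum essentially uniquely. -/
theorem exists_tupleEquiv_of_isSeparated (hL : L = ℚ⟮(Real.sqrt d)⟯) (hσ : σ ≠ AlgEquiv.refl)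
    (ρ : ℕ) :
    ∃ K : ℝ, 1 ≤ K ∧ ∀ (s t : Fin 3) (v w : Fin ρ → (𝓞 L)ˣ),
      (∀ i, K < |(realUnit L (v i) : ℝ)|) →
      IsSeparated K (fun i => |(realUnit L (v i) : ℝ)|) →
      NoVanishingSubsum (shape L σ ρ s v).2 → NoVanishingSubsum (shape L σ ρ t w).2 →
      ∑ i, (shape L σ ρ t w).2 i = ∑ i, (shape L σ ρ s v).2 i →
      TupleEquiv (shape L σ ρ s v) (shape L σ ρ t w) := by
  have hU := finite_annulus_range_realUnit hL hσ
  have hneg : -1 ∈ (realUnit L).range := ⟨-1, by ext; simp [coe_realUnit]⟩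
  choose K₀ hK₀ using fun m n : ℕ => exists_grouping hU hneg (Fin m) (Fin n)
  set N := Finset.range (ρ + ρ + 2) with hN
  set K : ℝ := 1 + ∑ m ∈ N, ∑ n ∈ N, |K₀ m n| with hK
  have hK1 : 1 ≤ K := le_add_of_nonneg_right
    (Finset.sum_nonneg fun _ _ => Finset.sum_nonneg fun _ _ => abs_nonneg _)
  have hKle : ∀ m ∈ N, ∀ n ∈ N, K₀ m n ≤ K := by
    intro m hm n hn
    have h1 : |K₀ m n| ≤ ∑ n ∈ N, |K₀ m n| :=
      Finset.single_le_sum (f := fun n => |K₀ m n|) (fun _ _ => abs_nonneg _) hn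
    have h2 : ∑ n ∈ N, |K₀ m n| ≤ ∑ m ∈ N, ∑ n ∈ N, |K₀ m n| :=
      Finset.single_le_sum (f := fun m => ∑ n ∈ N, |K₀ m n|)
        (fun _ _ => Finset.sum_nonneg fun _ _ => abs_nonneg _) hm
    linarith [le_abs_self (K₀ m n)]
  refine ⟨K, hK1, fun s t v w hvK hv hnu hnw hsum => ?_⟩
  obtain ⟨x, hxU, hx⟩ := exists_realUnit_lift hL hσ s v
  obtain ⟨y, hyU, hy⟩ := exists_realUnit_lift hL hσ t w
  have hmem : ∀ (s : Fin 3) (v : Fin ρ → (𝓞 L)ˣ), (shape L σ ρ s v).1 ∈ N := fun s v =>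
    Finset.mem_range.mpr (Nat.lt_succ_of_le (shape_length_le s v))
  obtain ⟨f, hf, hfK⟩ := hK₀ _ _ K (hKle _ (hmem s v) _ (hmem t w)) x y hxU hyU
    (by simpa only [hy] using hnw.real)
    (by simpa only [hx] using isSeparated_shape hL hσ hK1 s hvK hv)
    (by
      simp only [hx, hy]
      exact_mod_cast congrArg (fun z : L => (z : ℝ)) hsum.symm)
  have hsurj : Function.Surjective f := by
    intro a
    by_contra! h
    have h0 := hf a
    rw [Finset.filter_false_of_mem (fun b _ => h b), Finset.sum_empty] at h0
    exact (x a).ne_zero h0.symm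
  have hle : (shape L σ ρ t w).1 ≤ (shape L σ ρ s v).1 := by
    by_cases ht : t = 0
    · subst ht
      by_cases hs : s = 0
      · subst hs
        exact le_rfl
      · rw [(abs_shape_ne_zero hL hσ hs v).1]
        exact Nat.le_succ _
    · obtain ⟨h, habs⟩ := abs_shape_ne_zero hL hσ ht w
      by_cases hs : s = 0
      · subst hs
        have h1 := congrFun habs (Fin.natAdd (ρ + ρ) 0)
        rw [Fin.append_right, ← hy] at h1
        obtain ⟨h2, h3⟩ := hfK (Fin.cast h.symm (Fin.natAdd (ρ + ρ) 0))
        rw [h1, hx] at h2 h3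
        have h4 := congrFun (abs_shape_zero hL hσ v)
          (f (Fin.cast h.symm (Fin.natAdd (ρ + ρ) 0)))
        rw [h4] at h2 h3
        exact absurd h3 (append_inv_away_from_one hK1 hvK _ (by simpa using h2))
      · rw [h, (abs_shape_ne_zero hL hσ hs v).1]
  have hbij : Function.Bijective f :=
    (Fintype.bijective_iff_surjective_and_card f).mpr ⟨hsurj, by
      simpa using le_antisymm hle (by simpa using Fintype.card_le_of_surjective f hsurj)⟩
  refine ⟨Equiv.ofBijective f hbij, funext fun b => Subtype.ext ?_⟩
  have h0 := hf (f b)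
  have hfilter : Finset.univ.filter (fun b' => f b' = f b) = {b} := by
    ext b'
    simp [hbij.1.eq_iff]
  rw [hfilter, Finset.sum_singleton, hx, hy] at h0
  exact h0

theorem exists_mul_abs_le_abs_sum_shape (hL : L = ℚ⟮(Real.sqrt d)⟯) (hσ : σ ≠ AlgEquiv.refl)
    (ρ : ℕ) :
    ∃ c : ℝ, 0 < c ∧ ∀ (s : Fin 3) (v : Fin ρ → (𝓞 L)ˣ),
      NoVanishingSubsum (shape L σ ρ s v).2 → ∀ i,
      c * |(realUnit L (v i) : ℝ)| ≤ |((∑ p, (shape L σ ρ s v).2 p : L) : ℝ)| := by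
  choose c₀ hc₀ h using fun m : ℕ =>
    exists_mul_abs_le_abs_sum (finite_annulus_range_realUnit hL hσ) (Fin m) m
  obtain ⟨c, hc, hmin⟩ := ((Finset.range (ρ + ρ + 2)).finite_toSet.image c₀).exists_pos_forall_le
    (by rintro _ ⟨m, -, rfl⟩; exact hc₀ m)
  refine ⟨c, hc, fun s v hnv i => ?_⟩
  obtain ⟨x, hxU, hx⟩ := exists_realUnit_lift hL hσ s v
  obtain ⟨p, hp⟩ := exists_shape_eq (σ := σ) s v i
  have h1 := h _ Finset.univ (by simp) x hxU (fun I _ hI => by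
    simpa only [hx] using hnv.real I hI) p (Finset.mem_univ _)
  have h2 : c ≤ c₀ (shape L σ ρ s v).1 := hmin _ ⟨_, by
    simpa [Nat.lt_succ_iff] using shape_length_le s v, rfl⟩
  have hcast : ((∑ p, (shape L σ ρ s v).2 p : L) : ℝ) = ∑ p, (x p : ℝ) := by
    simp only [hx]
    push_cast
    rfl
  rw [hcast, coe_realUnit, ← hp, ← hx]
  exact (mul_le_mul_of_nonneg_right h2 (abs_nonneg _)).trans h1

end Shapes

/-- Proposition 11: the number of tuples in `𝒯_{k,ρ}(X)` which do not represent their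
coordinate sum essentially uniquely is `≪ (log X)^{ρ-1}`. -/
theorem non_unique_tuples_bound
    (d : ℕ) (hd : 2 ≤ d) (hsf : Squarefree d)
    (L : IntermediateField ℚ ℝ) (hL : L = ℚ⟮(Real.sqrt d)⟯)
    (σ : L ≃ₐ[ℚ] L) (hσ : σ ≠ AlgEquiv.refl)
    (k : ℕ) (hk : 1 ≤ k) :
    ∃ C : ℝ, 0 < C ∧ ∀ X : ℝ, 2 ≤ X →
      (Set.ncard {u ∈ TSet L σ k X | ∃ w ∈ TSet L σ k X,
          ¬ TupleEquiv u w ∧ (∑ i, w.2 i) = (∑ i, u.2 i)} : ℝ)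
        ≤ C * Real.log X ^ (((k / 2 : ℕ) : ℝ) - 1) := by
  obtain ⟨K, hK1, hK⟩ := exists_tupleEquiv_of_isSeparated hL hσ (k / 2)
  obtain ⟨c, hc, hcK⟩ := exists_mul_abs_le_abs_sum_shape hL hσ (k / 2)
  obtain ⟨C, hC, hcount⟩ := exists_ncard_clusteredTuples_le_rpow
    (finite_annulus_range_realUnit hL hσ) K hc (k / 2)
  refine ⟨3 * C + 1, by positivity, fun X hX => ?_⟩
  obtain ⟨hfin, hle⟩ := hcount X hX
  set B := clusteredTuples (realUnit L).range K c (k / 2) X with hB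
  let Φ : (Fin (k / 2) → (𝓞 L)ˣ) → (Fin (k / 2) → ℝˣ) := fun v i => realUnit L (v i)
  have hΦ : Function.Injective Φ := fun v w h =>
    funext fun i => realUnit_injective L (congrFun h i)
  have hfin' : (Φ ⁻¹' B).Finite := hfin.preimage hΦ.injOn
  have hle' : (Φ ⁻¹' B).ncard ≤ B.ncard :=
    Set.ncard_le_ncard_of_injOn Φ (fun _ h => h) hΦ.injOn hfin
  have hDfin : ((Set.univ : Set (Fin 3)) ×ˢ (Φ ⁻¹' B)).Finite := Set.finite_univ.prod hfin'
  have hsub : {u ∈ TSet L σ k X | ∃ w ∈ TSet L σ k X,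
      ¬ TupleEquiv u w ∧ (∑ i, w.2 i) = (∑ i, u.2 i)} ⊆
      (fun q : Fin 3 × (Fin (k / 2) → (𝓞 L)ˣ) => shape L σ (k / 2) q.1 q.2) ''
        ((Set.univ : Set (Fin 3)) ×ˢ (Φ ⁻¹' B)) := by
    rintro u ⟨hu, w, hw, hne, hsum⟩
    obtain ⟨s, v, hv, rfl⟩ := exists_shape_of_mem_TSet hu
    obtain ⟨t, w, -, rfl⟩ := exists_shape_of_mem_TSet hw
    refine ⟨(s, v), ⟨Set.mem_univ _, fun i => ⟨⟨v i, rfl⟩, hv i, ?_⟩, ?_⟩, rfl⟩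
    · exact (hcK s v hu.2.2.1 i).trans hu.2.2.2
    · by_contra! h
      refine hne (hK s t v w h.1 (fun i j h1 h2 => ?_) hu.2.2.1 hw.2.2.1 hsum)
      by_contra hij
      exact absurd h2 (not_le.mpr (h.2 i j hij h1))
  have hcard := (Set.ncard_le_ncard hsub (hDfin.image _)).trans (Set.ncard_image_le hDfin)
  rw [Set.ncard_prod, Set.ncard_univ, Nat.card_fin] at hcard
  have hlog : 0 ≤ Real.log X ^ (((k / 2 : ℕ) : ℝ) - 1) :=
    Real.rpow_nonneg (Real.log_nonneg (by linarith)) _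
  calc _ ≤ ((3 * (Φ ⁻¹' B).ncard : ℕ) : ℝ) := by exact_mod_cast hcard
    _ ≤ 3 * (B.ncard : ℝ) := by exact_mod_cast Nat.mul_le_mul_left 3 hle'
    _ ≤ 3 * (C * Real.log X ^ (((k / 2 : ℕ) : ℝ) - 1)) := by gcongr
    _ ≤ _ := by linarith
end
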